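/- arXiv:2305.12509 — 5 statements merged into one kernel-verified Lean document; each statement's English description precedes it below -/
import Mathlib

section
/- Let L be a first-order language, (M_i)_{i∈I} an indexed family of L-structures, D an ultrafilter on I, and ℳ = ∏_D M_i the ultraproduct. Suppose ℳ is NIP. Then every pseudo-finite Keisler measure μ over ℳ in variable x is finitely approximated: for every partitioned L-formula φ(x,y) and every ε > 0 there exists a finite tuple ā = (𝐚_1,…,𝐚_n) in ℳ^x such that sup_{𝐛 ∈ ℳ^y} |μ(φ(x,𝐛)) − Av(ā)(φ(x,𝐛))| < ε. -/
open FirstOrder FirstOrder.Language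

attribute [local instance] Classical.propDecidable

universe u v w

/-- A Keisler measure over the `L`-structure `M` in the tuple of variables indexed by `α`:
an assignment, to each formula `φ(x, b)` (with `x` indexed by `α`, parameter variables a
finite tuple, and parameters `b` from `M`) of a real number in `[0,1]`, depending only on the
definable subset of `M^α` defined, assigning `1` to all of `M^α`, and additive on disjoint
definable sets. -/
structure KeislerMeasure (L : FirstOrder.Language) (M : Type*) [L.Structure M] (α : Type*) where
  toFun : ∀ n : ℕ, L.Formula (α ⊕ Fin n) → (Fin n → M) → ℝ
  congr' : ∀ {n m : ℕ} (φ : L.Formula (α ⊕ Fin n)) (ψ : L.Formula (α ⊕ Fin m))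
      (b : Fin n → M) (c : Fin m → M),
      {a : α → M | φ.Realize (Sum.elim a b)} = {a : α → M | ψ.Realize (Sum.elim a c)} →
      toFun n φ b = toFun m ψ c
  nonneg : ∀ n φ b, 0 ≤ toFun n φ b
  le_one : ∀ n φ b, toFun n φ b ≤ 1
  measure_univ : ∀ (n : ℕ) (φ : L.Formula (α ⊕ Fin n)) (b : Fin n → M),
      {a : α → M | φ.Realize (Sum.elim a b)} = Set.univ → toFun n φ b = 1
  additive : ∀ {n m k : ℕ} (φ : L.Formula (α ⊕ Fin n)) (ψ : L.Formula (α ⊕ Fin m))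
      (θ : L.Formula (α ⊕ Fin k)) (b : Fin n → M) (c : Fin m → M) (d : Fin k → M),
      {a : α → M | φ.Realize (Sum.elim a b)} ∩ {a : α → M | ψ.Realize (Sum.elim a c)} = ∅ →
      {a : α → M | θ.Realize (Sum.elim a d)} =
        {a : α → M | φ.Realize (Sum.elim a b)} ∪ {a : α → M | ψ.Realize (Sum.elim a c)} →
      toFun k θ d = toFun n φ b + toFun m ψ c

variable {L : FirstOrder.Language} {M : Type*} [L.Structure M] {α : Type*}

/-- The average measure `Av(ā)` of the tuple `ā = (a_1, …, a_k)` of elements of `M^α`,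
evaluated on the formula `φ(x, b)`: the proportion of the `a_j` satisfying `φ(x, b)`. -/
noncomputable def KeislerAvg {k : ℕ} (as : Fin k → (α → M)) (n : ℕ)
    (φ : L.Formula (α ⊕ Fin n)) (b : Fin n → M) : ℝ :=
  (Nat.card {j : Fin k // φ.Realize (Sum.elim (as j) b)} : ℝ) / k

/-- A Keisler measure is finitely approximated if for every partitioned formula `φ(x,y)` and
every `ε > 0` there is an average measure `Av(ā)`, `ā` a nonempty finite tuple from `M^α`,
within `ε` of `μ` uniformly over all parameters `b ∈ M^y`. -/
def KeislerMeasure.FinitelyApproximated (μ : KeislerMeasure L M α) : Prop :=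
  ∀ (n : ℕ) (φ : L.Formula (α ⊕ Fin n)) (ε : ℝ), 0 < ε →
    ∃ (k : ℕ) (as : Fin k → (α → M)), 0 < k ∧
      ∀ b : Fin n → M, |μ.toFun n φ b - KeislerAvg as n φ b| < ε

/-- A Keisler measure lies in `conv_α(M)` if it is a finite convex combination
`Σ r_j δ_{a_j}` of Dirac measures at realized points `a_j ∈ M^α`. -/
def KeislerMeasure.IsConvComb (μ : KeislerMeasure L M α) : Prop :=
  ∃ (m : ℕ) (r : Fin m → ℝ) (a : Fin m → (α → M)),
    (∀ j, 0 < r j) ∧ (∑ j, r j = 1) ∧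
    ∀ n (φ : L.Formula (α ⊕ Fin n)) (b : Fin n → M),
      μ.toFun n φ b = ∑ j, if φ.Realize (Sum.elim (a j) b) then r j else 0

/-- `IsDLim D f r`: the real `r` is the limit of the family `f` along the ultrafilter `D`,
i.e. for every `ε > 0` the set `{i | |f i - r| ≤ ε}` belongs to `D`. -/
def IsDLim {I : Type*} (D : Ultrafilter I) (f : I → ℝ) (r : ℝ) : Prop :=
  ∀ ε : ℝ, 0 < ε → {i | |f i - r| ≤ ε} ∈ D

section Ultra

variable {I : Type*} {M : I → Type v} [∀ i, L.Structure (M i)]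

/-- `μ` is the ultralimit of the family `μi` of Keisler measures on the factors: for every
formula `φ(x,y)`, every tuple of parameters in the ultraproduct, and every representative
family of the parameters, the values of `μi` converge along `D` to the value of `μ`. -/
def IsUltralimit (D : Ultrafilter I) (μi : ∀ i, KeislerMeasure L (M i) α)
    (μ : KeislerMeasure L ((D : Filter I).Product M) α) : Prop :=
  ∀ (n : ℕ) (φ : L.Formula (α ⊕ Fin n)) (b : ∀ i, Fin n → M i),
    IsDLim D (fun i => (μi i).toFun n φ (b i))
      (μ.toFun n φ (fun j => (↑(fun i => b i j) : (D : Filter I).Product M)))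

/-- A Keisler measure on the ultraproduct `∏_D M i` is pseudo-finite (with respect to the
family `(M i)` and the ultrafilter `D`) if it is the ultralimit of a family of finite convex
combinations of Dirac measures on the factors. -/
def KeislerMeasure.PseudoFinite (D : Ultrafilter I)
    (μ : KeislerMeasure L ((D : Filter I).Product M) α) : Prop :=
  ∃ μi : ∀ i, KeislerMeasure L (M i) α, (∀ i, (μi i).IsConvComb) ∧ IsUltralimit D μi μ

end Ultra

/-- A structure `N` is NIP if for every partitioned formula `φ(x,y)` there is a bound `k`
such that `φ` does not shatter a set of size `k`. -/
def IsNIPStructure (L : FirstOrder.Language) (N : Type*) [L.Structure N] : Prop :=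
  ∀ (p n : ℕ) (φ : L.Formula (Fin p ⊕ Fin n)), ∃ k : ℕ,
    ¬ ∃ (a : Finset (Fin k) → (Fin p → N)) (b : Fin k → (Fin n → N)),
      ∀ (s : Finset (Fin k)) (j : Fin k), φ.Realize (Sum.elim (a s) (b j)) ↔ j ∈ s

open Finset in
/-- **Sauer–Shelah**, as a polynomial bound on the number of traces on a finite set. -/
lemma card_image_inter_le_of_shatters_card_lt {Ω : Type*} {𝒜 : Finset (Finset Ω)} {k : ℕ}
    (h𝒜 : ∀ s, 𝒜.Shatters s → #s < k) (S : Finset Ω) :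
    #(𝒜.image (· ∩ S)) ≤ k * (#S + 1) ^ k := by
  have hsub : (𝒜.image (· ∩ S)).shatterer ⊆ (range k).biUnion fun i => S.powersetCard i := by
    intro t ht
    have ht := mem_shatterer.1 ht
    have htS : t ⊆ S := by
      obtain ⟨u, hu, htu⟩ := ht.exists_superset
      obtain ⟨A, -, rfl⟩ := mem_image.1 hu
      exact htu.trans inter_subset_right
    have hsh : 𝒜.Shatters t := by
      intro v hv
      obtain ⟨u, hu, rfl⟩ := ht hv
      obtain ⟨A, hA, rfl⟩ := mem_image.1 hu
      exact ⟨A, hA, by rw [← inter_assoc, inter_right_comm, inter_eq_left.2 htS]⟩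
    simpa using ⟨h𝒜 t hsh, htS⟩
  calc #(𝒜.image (· ∩ S)) ≤ #((range k).biUnion fun i => S.powersetCard i) :=
        (card_le_card_shatterer _).trans (card_le_card hsub)
    _ ≤ ∑ i ∈ range k, #(S.powersetCard i) := card_biUnion_le
    _ ≤ ∑ _i ∈ range k, (#S + 1) ^ k := by
        refine sum_le_sum fun i hi => ?_
        rw [card_powersetCard]
        calc (#S).choose i ≤ #S ^ i := Nat.choose_le_pow _ _
          _ ≤ (#S + 1) ^ i := by gcongr; omega
          _ ≤ (#S + 1) ^ k := Nat.pow_le_pow_right (Nat.succ_pos _) (mem_range.1 hi).le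
    _ = k * (#S + 1) ^ k := by simp

/-- The averaged exponential of a sum with random signs, for coefficients in `[-1, 1]`. -/
lemma sum_exp_signed_sum_le {N : ℕ} (t : ℝ) (v : Fin N → ℝ) (hv : ∀ i, |v i| ≤ 1) :
    ∑ σ : Fin N → Bool, Real.exp (t * ∑ i, if σ i then v i else -v i) ≤
      2 ^ N * Real.exp (t ^ 2 / 2 * N) := by
  have key : ∀ i, ∑ s : Bool, Real.exp (t * if s then v i else -v i) ≤
      2 * Real.exp (t ^ 2 / 2) := by
    intro i
    have h1 := Real.cosh_le_exp_half_sq (t * v i)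
    have h2 : Real.exp ((t * v i) ^ 2 / 2) ≤ Real.exp (t ^ 2 / 2) := by
      have : v i ^ 2 ≤ 1 := (sq_le_one_iff_abs_le_one _).2 (hv i)
      rw [mul_pow]
      exact Real.exp_le_exp.2 (by nlinarith [sq_nonneg t])
    rw [Real.cosh_eq] at h1
    simp only [Fintype.sum_bool, if_true, Bool.false_eq_true, if_false, mul_neg]
    linarith
  calc ∑ σ : Fin N → Bool, Real.exp (t * ∑ i, if σ i then v i else -v i)
      = ∏ i, ∑ s : Bool, Real.exp (t * if s then v i else -v i) := by
        rw [Finset.prod_univ_sum, Fintype.piFinset_univ]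
        exact Finset.sum_congr rfl fun σ _ => by rw [Finset.mul_sum, Real.exp_sum]
    _ ≤ ∏ _i : Fin N, 2 * Real.exp (t ^ 2 / 2) :=
        Finset.prod_le_prod (fun i _ => by positivity) fun i _ => key i
    _ = _ := by
        rw [Finset.prod_const, mul_pow, ← Real.exp_nat_mul, Finset.card_univ, Fintype.card_fin, mul_comm (t ^ 2 / 2)]

/-- The sampling discrepancy of `A` between the two coordinates of a sequence of pairs. -/
noncomputable def pairDiscrepancy {Ω : Type*} {N : ℕ} (A : Finset Ω) (h : Fin N → Ω × Ω) : ℝ :=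
  ∑ i, ((if (h i).1 ∈ A then (1 : ℝ) else 0) - if (h i).2 ∈ A then (1 : ℝ) else 0)

/-- The points occurring in a sequence of pairs. -/
noncomputable def pairSupport {Ω : Type*} {N : ℕ} (h : Fin N → Ω × Ω) : Finset Ω :=
  Finset.univ.image (fun i => (h i).1) ∪ Finset.univ.image (fun i => (h i).2)

/-- Exchange the two members of the `i`-th pair whenever `σ i` is false. -/
def pairSwap (Ω : Type*) {N : ℕ} (σ : Fin N → Bool) : (Fin N → Ω × Ω) ≃ (Fin N → Ω × Ω) :=
  Equiv.piCongrRight fun i => if σ i then Equiv.refl _ else Equiv.prodComm _ _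

section Pair

variable {Ω : Type*} {N : ℕ}

lemma pairSwap_apply (σ : Fin N → Bool) (h : Fin N → Ω × Ω) (i : Fin N) :
    pairSwap Ω σ h i = if σ i then h i else (h i).swap := by
  simp only [pairSwap, Equiv.piCongrRight_apply, Pi.map_apply]
  split <;> rfl

lemma pairDiscrepancy_inter_pairSupport (A : Finset Ω) (h : Fin N → Ω × Ω) :
    pairDiscrepancy (A ∩ pairSupport h) h = pairDiscrepancy A h := by
  refine Finset.sum_congr rfl fun i _ => ?_
  have h1 : (h i).1 ∈ pairSupport h := by simp [pairSupport]
  have h2 : (h i).2 ∈ pairSupport h := by simp [pairSupport]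
  simp [h1, h2]

lemma pairSupport_pairSwap (σ : Fin N → Bool) (h : Fin N → Ω × Ω) :
    pairSupport (pairSwap Ω σ h) = pairSupport h := by
  ext x
  simp only [pairSupport, Finset.mem_union, Finset.mem_image, Finset.mem_univ, true_and,
    pairSwap_apply, ← exists_or]
  refine exists_congr fun i => ?_
  cases σ i <;> simp [or_comm]

lemma card_pairSupport_le (h : Fin N → Ω × Ω) : (pairSupport h).card ≤ 2 * N := by
  refine (Finset.card_union_le _ _).trans ?_
  have := Finset.card_image_le (s := Finset.univ) (f := fun i => (h i).1)
  have := Finset.card_image_le (s := Finset.univ) (f := fun i => (h i).2)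
  simp only [Finset.card_univ, Fintype.card_fin] at *
  omega

lemma pairDiscrepancy_pairSwap (A : Finset Ω) (σ : Fin N → Bool) (h : Fin N → Ω × Ω) :
    pairDiscrepancy A (pairSwap Ω σ h) = ∑ i, if σ i then
      ((if (h i).1 ∈ A then (1 : ℝ) else 0) - if (h i).2 ∈ A then (1 : ℝ) else 0) else
      -((if (h i).1 ∈ A then (1 : ℝ) else 0) - if (h i).2 ∈ A then (1 : ℝ) else 0) := by
  refine Finset.sum_congr rfl fun i _ => ?_
  rw [pairSwap_apply]
  cases σ i <;> simp

lemma sum_exp_pairDiscrepancy_pairSwap_le (t : ℝ) (A : Finset Ω) (h : Fin N → Ω × Ω) :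
    ∑ σ : Fin N → Bool, Real.exp (t * pairDiscrepancy A (pairSwap Ω σ h)) ≤
      2 ^ N * Real.exp (t ^ 2 / 2 * N) := by
  have := sum_exp_signed_sum_le t (fun i => (if (h i).1 ∈ A then (1 : ℝ) else 0) -
    if (h i).2 ∈ A then (1 : ℝ) else 0) fun i => by split_ifs <;> simp
  simpa only [pairDiscrepancy_pairSwap] using this

/-- Sum, over all traces of `𝒜` on a sequence of pairs, of the two-sided exponential discrepancy. -/
noncomputable def traceExpSum (t : ℝ) (𝒜 : Finset (Finset Ω)) (h : Fin N → Ω × Ω) : ℝ :=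
  ∑ B ∈ 𝒜.image (· ∩ pairSupport h),
    (Real.exp (t * pairDiscrepancy B h) + Real.exp (-t * pairDiscrepancy B h))

lemma exp_pairDiscrepancy_le_traceExpSum (t : ℝ) {𝒜 : Finset (Finset Ω)} {A : Finset Ω}
    (hA : A ∈ 𝒜) (h : Fin N → Ω × Ω) :
    Real.exp (t * pairDiscrepancy A h) + Real.exp (-t * pairDiscrepancy A h) ≤
      traceExpSum t 𝒜 h := by
  rw [← pairDiscrepancy_inter_pairSupport]
  exact Finset.single_le_sum (f := fun B => Real.exp (t * pairDiscrepancy B h) +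
    Real.exp (-t * pairDiscrepancy B h)) (fun B _ => by positivity)
    (Finset.mem_image_of_mem (· ∩ pairSupport h) hA)

lemma sum_traceExpSum_pairSwap_le (t : ℝ) {𝒜 : Finset (Finset Ω)} {k : ℕ}
    (h𝒜 : ∀ s, 𝒜.Shatters s → s.card < k) (h : Fin N → Ω × Ω) :
    ∑ σ : Fin N → Bool, traceExpSum t 𝒜 (pairSwap Ω σ h) ≤
      (k * (2 * N + 1) ^ k) * (2 * (2 ^ N * Real.exp (t ^ 2 / 2 * N))) := by
  simp only [traceExpSum, pairSupport_pairSwap]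
  rw [Finset.sum_comm]
  refine (Finset.sum_le_card_nsmul _ _ (2 * (2 ^ N * Real.exp (t ^ 2 / 2 * N)))
    fun B _ => ?_).trans ?_
  · rw [Finset.sum_add_distrib]
    have h1 := sum_exp_pairDiscrepancy_pairSwap_le t B h
    have h2 := sum_exp_pairDiscrepancy_pairSwap_le (-t) B h
    rw [neg_sq] at h2
    linarith
  · rw [nsmul_eq_mul]
    gcongr
    have h1 := card_image_inter_le_of_shatters_card_lt h𝒜 (pairSupport h)
    have h2 : k * ((pairSupport h).card + 1) ^ k ≤ k * (2 * N + 1) ^ k := by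
      gcongr
      exact card_pairSupport_le h
    exact_mod_cast h1.trans h2

variable [Fintype Ω] {r : Ω → ℝ}

/-- Symmetrization: the weighted average of the trace sum is bounded by averaging over swaps. -/
lemma sum_weight_mul_traceExpSum_le (hr : ∀ x, 0 ≤ r x) (hr1 : ∑ x, r x = 1) (t : ℝ)
    {𝒜 : Finset (Finset Ω)} {k : ℕ} (h𝒜 : ∀ s, 𝒜.Shatters s → s.card < k) :
    ∑ h : Fin N → Ω × Ω, (∏ i, r (h i).1 * r (h i).2) * traceExpSum t 𝒜 h ≤
      2 * (k * (2 * N + 1) ^ k) * Real.exp (t ^ 2 / 2 * N) := by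
  set W : (Fin N → Ω × Ω) → ℝ := fun h => ∏ i, r (h i).1 * r (h i).2
  have hW0 : ∀ h, 0 ≤ W h := fun h => Finset.prod_nonneg fun i _ => mul_nonneg (hr _) (hr _)
  have hW1 : ∑ h, W h = 1 := by
    have := Finset.prod_univ_sum (fun _ : Fin N => (Finset.univ : Finset (Ω × Ω)))
      (fun _ p => r p.1 * r p.2)
    rw [Fintype.piFinset_univ] at this
    rw [← this]
    simp [Fintype.sum_prod_type, ← Finset.mul_sum, hr1]
  have hWs : ∀ σ h, W (pairSwap Ω σ h) = W h := fun σ h =>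
    Finset.prod_congr rfl fun i _ => by
      rw [pairSwap_apply]
      cases σ i <;> simp [mul_comm]
  have hswap : ∀ σ : Fin N → Bool, ∑ h, W h * traceExpSum t 𝒜 h =
      ∑ h, W h * traceExpSum t 𝒜 (pairSwap Ω σ h) := fun σ => by
    rw [← Equiv.sum_comp (pairSwap Ω σ)]
    simp only [hWs]
  have h2 : (2 : ℝ) ^ N * ∑ h, W h * traceExpSum t 𝒜 h =
      ∑ h, W h * ∑ σ : Fin N → Bool, traceExpSum t 𝒜 (pairSwap Ω σ h) := by
    simp only [Finset.mul_sum (Finset.univ : Finset (Fin N → Bool))]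
    rw [Finset.sum_comm, ← Finset.sum_congr rfl fun σ _ => hswap σ]
    simp
  have h3 : (2 : ℝ) ^ N * ∑ h, W h * traceExpSum t 𝒜 h ≤
      2 ^ N * (2 * (k * (2 * N + 1) ^ k) * Real.exp (t ^ 2 / 2 * N)) := by
    rw [h2]
    calc _ ≤ ∑ h, W h * ((k * (2 * N + 1) ^ k) * (2 * (2 ^ N * Real.exp (t ^ 2 / 2 * N)))) := by
          gcongr with h
          · exact hW0 h
          · exact sum_traceExpSum_pairSwap_le t h𝒜 h
      _ = _ := by rw [← Finset.sum_mul, hW1]; ring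
  exact le_of_mul_le_mul_left h3 (by positivity)

/-- Jensen's inequality for a ghost sample. -/
lemma exp_sampling_error_le (hr : ∀ x, 0 ≤ r x) (hr1 : ∑ x, r x = 1) (t : ℝ) (A : Finset Ω)
    (f : Fin N → Ω) :
    Real.exp (t * ∑ i, ((if f i ∈ A then (1 : ℝ) else 0) - ∑ x ∈ A, r x)) ≤
      ∑ g : Fin N → Ω, (∏ i, r (g i)) *
        Real.exp (t * pairDiscrepancy A fun i => (f i, g i)) := by
  have key : ∀ i, Real.exp (t * ((if f i ∈ A then (1 : ℝ) else 0) - ∑ x ∈ A, r x)) ≤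
      ∑ x, r x * Real.exp (t * ((if f i ∈ A then (1 : ℝ) else 0) -
        if x ∈ A then (1 : ℝ) else 0)) := by
    intro i
    have := convexOn_exp.map_sum_le (t := Finset.univ) (w := r)
      (p := fun x => t * ((if f i ∈ A then (1 : ℝ) else 0) - if x ∈ A then (1 : ℝ) else 0))
      (fun x _ => hr x) hr1 (fun _ _ => Set.mem_univ _)
    simp only [smul_eq_mul] at this
    refine le_trans (le_of_eq ?_) this
    congr 1
    have e : ∀ x, r x * (t * ((if f i ∈ A then (1 : ℝ) else 0) - if x ∈ A then (1 : ℝ) else 0)) =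
        r x * (t * if f i ∈ A then (1 : ℝ) else 0) - t * (if x ∈ A then r x else 0) := by
      intro x; split_ifs <;> ring
    simp only [e, Finset.sum_sub_distrib, ← Finset.sum_mul, ← Finset.mul_sum, hr1]
    rw [Finset.sum_ite_mem, Finset.univ_inter]
    ring
  calc _ = ∏ i, Real.exp (t * ((if f i ∈ A then (1 : ℝ) else 0) - ∑ x ∈ A, r x)) := by
        rw [Finset.mul_sum, Real.exp_sum]
    _ ≤ ∏ i, ∑ x, r x * Real.exp (t * ((if f i ∈ A then (1 : ℝ) else 0) -
        if x ∈ A then (1 : ℝ) else 0)) :=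
        Finset.prod_le_prod (fun i _ => by positivity) fun i _ => key i
    _ = _ := by
        rw [Finset.prod_univ_sum, Fintype.piFinset_univ]
        refine Finset.sum_congr rfl fun g _ => ?_
        rw [Finset.prod_mul_distrib, ← Real.exp_sum, ← Finset.mul_sum]
        rfl

end Pair

/-- **Vapnik–Chervonenkis theorem** for finitely supported probability measures: the sample size
depends only on the shattering bound and the precision. -/
theorem exists_uniform_sample_of_shatters_card_lt (k : ℕ) {ε : ℝ} (hε : 0 < ε) :
    ∃ N : ℕ, 0 < N ∧ ∀ {Ω : Type} [Fintype Ω] (r : Ω → ℝ) (𝒜 : Finset (Finset Ω)),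
      (∀ x, 0 ≤ r x) → ∑ x, r x = 1 → (∀ s, 𝒜.Shatters s → s.card < k) →
      ∃ f : Fin N → Ω, ∀ A ∈ 𝒜,
        |∑ x ∈ A, r x - (Nat.card {i : Fin N // f i ∈ A} : ℝ) / N| ≤ ε := by
  have hlim : ∃ N : ℕ, 0 < N ∧
      2 * (k * (2 * (N : ℝ) + 1) ^ k) * Real.exp (ε ^ 2 / 2 * N) < Real.exp (ε * (ε * N)) := by
    have ho := (isLittleO_pow_exp_pos_mul_atTop k (b := ε ^ 2 / 2) (by positivity)).comp_tendsto
      (tendsto_natCast_atTop_atTop (R := ℝ))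
    have hC : (0 : ℝ) < 1 / (2 * k * 3 ^ k + 1) := by positivity
    obtain ⟨N, hN, hN0⟩ := ((ho.bound hC).and (Filter.eventually_gt_atTop 0)).exists
    refine ⟨N, hN0, ?_⟩
    have hN1 : (1 : ℝ) ≤ N := by exact_mod_cast hN0
    simp only [Function.comp_apply, Real.norm_eq_abs, Real.abs_exp] at hN
    rw [abs_of_nonneg (by positivity), one_div_mul_eq_div, le_div_iff₀ (by positivity)] at hN
    have hsplit : Real.exp (ε * (ε * N)) =
        Real.exp (ε ^ 2 / 2 * N) * Real.exp (ε ^ 2 / 2 * N) := by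
      rw [← Real.exp_add]; ring_nf
    rw [hsplit]
    refine mul_lt_mul_of_pos_right ?_ (Real.exp_pos _)
    have hp : (2 * (N : ℝ) + 1) ^ k ≤ 3 ^ k * N ^ k := by
      rw [← mul_pow]
      gcongr
      linarith
    have hpos : (0 : ℝ) < (N : ℝ) ^ k := by positivity
    calc 2 * (k * (2 * (N : ℝ) + 1) ^ k) ≤ 2 * (k * (3 ^ k * N ^ k)) := by gcongr
      _ < N ^ k * (2 * k * 3 ^ k + 1) := by linarith
      _ ≤ _ := hN
  obtain ⟨N, hN0, hN⟩ := hlim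
  refine ⟨N, hN0, fun {Ω} _ r 𝒜 hr hr1 h𝒜 => ?_⟩
  by_contra! hcon
  have hNpos : (0 : ℝ) < N := by exact_mod_cast hN0
  have hf : ∀ f : Fin N → Ω, Real.exp (ε * (ε * N)) ≤
      ∑ g : Fin N → Ω, (∏ i, r (g i)) * traceExpSum ε 𝒜 fun i => (f i, g i) := by
    intro f
    obtain ⟨A, hA, hAf⟩ := hcon f
    set z := ∑ i, ((if f i ∈ A then (1 : ℝ) else 0) - ∑ x ∈ A, r x) with hz
    have hz' : z = (Nat.card {i : Fin N // f i ∈ A} : ℝ) - N * ∑ x ∈ A, r x := by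
      rw [hz, Finset.sum_sub_distrib, Finset.sum_boole, Nat.card_eq_fintype_card,
        Fintype.card_subtype]
      simp
    have habs : ε * N ≤ |z| := by
      have : |z| = |∑ x ∈ A, r x - (Nat.card {i : Fin N // f i ∈ A} : ℝ) / N| * N := by
        rw [← abs_of_pos hNpos, ← abs_mul, abs_of_pos hNpos, hz', abs_sub_comm]
        congr 1
        field_simp
      rw [this]
      gcongr
    calc Real.exp (ε * (ε * N)) ≤ Real.exp (ε * |z|) := by gcongr
      _ ≤ Real.exp (ε * z) + Real.exp (-ε * z) := by
          rcases abs_cases z with ⟨h, -⟩ | ⟨h, -⟩ <;> rw [h]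
          · linarith [Real.exp_pos (-ε * z)]
          · rw [mul_neg, ← neg_mul]
            linarith [Real.exp_pos (ε * z)]
      _ ≤ _ := add_le_add (exp_sampling_error_le hr hr1 ε A f)
          (exp_sampling_error_le hr hr1 (-ε) A f)
      _ = ∑ g : Fin N → Ω, (∏ i, r (g i)) *
            (Real.exp (ε * pairDiscrepancy A fun i => (f i, g i)) +
              Real.exp (-ε * pairDiscrepancy A fun i => (f i, g i))) := by
          rw [← Finset.sum_add_distrib]
          simp only [mul_add]
      _ ≤ _ := by
          gcongr with g
          · exact Finset.prod_nonneg fun i _ => hr _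
          · exact exp_pairDiscrepancy_le_traceExpSum ε hA _
  have hw1 : ∑ f : Fin N → Ω, ∏ i, r (f i) = 1 := by
    have := Finset.prod_univ_sum (fun _ : Fin N => (Finset.univ : Finset Ω)) (fun _ => r)
    rw [Fintype.piFinset_univ] at this
    rw [← this]
    simp [hr1]
  refine absurd hN (not_lt.2 ?_)
  calc Real.exp (ε * (ε * N)) = ∑ f : Fin N → Ω, (∏ i, r (f i)) * Real.exp (ε * (ε * N)) := by
        rw [← Finset.sum_mul, hw1, one_mul]
    _ ≤ ∑ f : Fin N → Ω, (∏ i, r (f i)) *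
          ∑ g : Fin N → Ω, (∏ i, r (g i)) * traceExpSum ε 𝒜 fun i => (f i, g i) := by
        gcongr with f
        · exact Finset.prod_nonneg fun i _ => hr _
        · exact hf f
    _ = ∑ h : Fin N → Ω × Ω, (∏ i, r (h i).1 * r (h i).2) * traceExpSum ε 𝒜 h := by
        rw [← Equiv.sum_comp (Equiv.arrowProdEquivProdArrow (Fin N) (fun _ => Ω)
          (fun _ => Ω)).symm, Fintype.sum_prod_type]
        refine Finset.sum_congr rfl fun f _ => ?_
        rw [Finset.mul_sum]
        refine Finset.sum_congr rfl fun g _ => ?_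
        simp only [Equiv.arrowProdEquivProdArrow, Equiv.coe_fn_symm_mk, Finset.prod_mul_distrib]
        ring
    _ ≤ _ := sum_weight_mul_traceExpSum_le hr hr1 ε h𝒜

section Measures

variable {L : FirstOrder.Language} {M : Type*} [L.Structure M] {α : Type*}

lemma KeislerMeasure.toFun_eq_zero (μ : KeislerMeasure L M α) {n : ℕ}
    (φ : L.Formula (α ⊕ Fin n)) (b : Fin n → M)
    (h : {a : α → M | φ.Realize (Sum.elim a b)} = ∅) : μ.toFun n φ b = 0 := by
  have := μ.additive φ φ φ b b b (by simp [h]) (by simp)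
  linarith

lemma KeislerMeasure.nonempty (μ : KeislerMeasure L M α) : Nonempty (α → M) := by
  by_contra hne
  rw [not_nonempty_iff] at hne
  have h0 := μ.toFun_eq_zero (⊥ : L.Formula (α ⊕ Fin 0)) Fin.elim0 (Set.eq_empty_of_isEmpty _)
  have h1 := μ.measure_univ 0 (⊥ : L.Formula (α ⊕ Fin 0)) Fin.elim0 (Subsingleton.elim _ _)
  exact zero_ne_one (h0.symm.trans h1)

lemma KeislerMeasure.finitelyApproximated_of_subsingleton [Subsingleton (α → M)]
    (μ : KeislerMeasure L M α) : μ.FinitelyApproximated := by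
  intro n φ ε hε
  obtain ⟨a⟩ := μ.nonempty
  refine ⟨1, fun _ => a, one_pos, fun b => ?_⟩
  by_cases h : φ.Realize (Sum.elim a b)
  · rw [μ.measure_univ n φ b (Set.eq_univ_of_forall fun a' => by
      rwa [Set.mem_ofPred_eq, Subsingleton.elim a' a])]
    simpa [KeislerAvg, h] using hε
  · rw [μ.toFun_eq_zero φ b (Set.eq_empty_of_forall_notMem fun a' => by
      rwa [Set.mem_ofPred_eq, Subsingleton.elim a' a])]
    simpa [KeislerAvg, h] using hε

/-- The sets `φ(a_j, b)`, `b ∈ M^n`, shatter no `k` points of `M^α`. -/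
def ShattersNo {n : ℕ} (M : Type*) [L.Structure M] (φ : L.Formula (α ⊕ Fin n)) (k : ℕ) : Prop :=
  ¬ ∃ (b : Finset (Fin k) → (Fin n → M)) (a : Fin k → (α → M)),
    ∀ (s : Finset (Fin k)) (j : Fin k), φ.Realize (Sum.elim (a j) (b s)) ↔ j ∈ s

lemma IsNIPStructure.exists_shattersNo {p n : ℕ} (h : IsNIPStructure L M)
    (φ : L.Formula (Fin p ⊕ Fin n)) : ∃ k, ShattersNo M φ k := by
  obtain ⟨k, hk⟩ := h n p (φ.relabel Sum.swap)
  refine ⟨k, fun ⟨b, a, hab⟩ => hk ⟨b, a, fun s j => ?_⟩⟩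
  rw [Formula.realize_relabel, ← hab s j]
  congr! 1
  ext x
  cases x <;> rfl

/-- The traces of the sets `φ(x, b)` on a finite family of points. -/
noncomputable def formulaTraces {n m : ℕ} (φ : L.Formula (α ⊕ Fin n)) (a : Fin m → (α → M)) :
    Finset (Finset (Fin m)) :=
  Finset.univ.filter fun A => ∃ b : Fin n → M,
    A = Finset.univ.filter fun j => φ.Realize (Sum.elim (a j) b)

lemma ShattersNo.card_lt {n m k : ℕ} {φ : L.Formula (α ⊕ Fin n)} (h : ShattersNo M φ k)
    (a : Fin m → (α → M)) {s : Finset (Fin m)} (hs : (formulaTraces φ a).Shatters s) :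
    s.card < k := by
  by_contra! hk
  let e := s.orderEmbOfCardLe hk
  have he : ∀ j, e j ∈ s := s.orderEmbOfCardLe_mem hk
  have hex : ∀ u : Finset (Fin k), ∃ b : Fin n → M,
      ∀ j, φ.Realize (Sum.elim (a (e j)) b) ↔ j ∈ u := by
    intro u
    obtain ⟨A, hA, hsA⟩ := @hs (u.image e) (Finset.image_subset_iff.2 fun j _ => he j)
    obtain ⟨b, rfl⟩ := (Finset.mem_filter.1 hA).2
    refine ⟨b, fun j => ?_⟩
    have := Finset.ext_iff.1 hsA (e j)
    simpa [he j] using this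
  choose b hb using hex
  exact h ⟨b, fun j => a (e j), hb⟩

end Measures

/-- Convex combinations of Dirac measures are uniformly approximated on `φ` by averages of tuples
whose length depends only on the shattering bound of `φ` and on the precision. -/
lemma exists_forall_isConvComb_approx (k : ℕ) {ε : ℝ} (hε : 0 < ε) :
    ∃ N : ℕ, 0 < N ∧ ∀ {L : FirstOrder.Language} {M : Type*} [L.Structure M] {α : Type*} {n : ℕ}
      {φ : L.Formula (α ⊕ Fin n)} {μ : KeislerMeasure L M α}, ShattersNo M φ k → μ.IsConvComb →
      ∃ as : Fin N → (α → M), ∀ b : Fin n → M, |μ.toFun n φ b - KeislerAvg as n φ b| ≤ ε := by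
  obtain ⟨N, hN, hsample⟩ := exists_uniform_sample_of_shatters_card_lt k hε
  refine ⟨N, hN, fun {L M _ α n φ μ} hφ ⟨m, r, a, hr, hr1, hμ⟩ => ?_⟩
  obtain ⟨f, hf⟩ := hsample r (formulaTraces φ a) (fun j => (hr j).le) hr1
    fun s hs => hφ.card_lt a (by convert hs)
  refine ⟨fun i => a (f i), fun b => ?_⟩
  have := hf (Finset.univ.filter fun j => φ.Realize (Sum.elim (a j) b))
    (Finset.mem_filter.2 ⟨Finset.mem_univ _, b, rfl⟩)
  rw [hμ, ← Finset.sum_filter]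
  simpa [KeislerAvg] using this

section Ultraproduct

variable {L : FirstOrder.Language} {I : Type*} {M : I → Type v} [∀ i, L.Structure (M i)]
  {D : Ultrafilter I}

/-- **Łoś's theorem** for formulas in two groups of variables. -/
lemma realize_sumElim_product_cast [∀ i, Nonempty (M i)] {α β : Type*} (φ : L.Formula (α ⊕ β))
    (a : ∀ i, α → M i) (b : ∀ i, β → M i) :
    φ.Realize (Sum.elim (fun j => (↑(fun i => a i j) : (D : Filter I).Product M))
      (fun j => (↑(fun i => b i j) : (D : Filter I).Product M))) ↔
      ∀ᶠ i in D, φ.Realize (Sum.elim (a i) (b i)) := by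
  convert! Ultraproduct.realize_formula_cast (u := D) φ
    (Sum.elim (fun j i => a i j) (fun j i => b i j)) using 2
  · ext x; cases x <;> rfl
  · congr! 2; ext x; cases x <;> rfl

lemma ShattersNo.eventually [∀ i, Nonempty (M i)] {α : Type*} {n k : ℕ}
    {φ : L.Formula (α ⊕ Fin n)} (h : ShattersNo ((D : Filter I).Product M) φ k) :
    ∀ᶠ i in D, ShattersNo (M i) φ k := by
  by_contra hcon
  rw [← Ultrafilter.eventually_not] at hcon
  have hex : ∀ i, ∃ (b : Finset (Fin k) → (Fin n → M i)) (a : Fin k → (α → M i)),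
      ¬ ShattersNo (M i) φ k → ∀ (s : Finset (Fin k)) (j : Fin k),
        φ.Realize (Sum.elim (a j) (b s)) ↔ j ∈ s := by
    intro i
    by_cases hi : ShattersNo (M i) φ k
    · exact ⟨fun _ _ => Classical.arbitrary _, fun _ _ => Classical.arbitrary _,
        fun h => absurd hi h⟩
    · obtain ⟨b, a, hab⟩ := not_not.1 hi
      exact ⟨b, a, fun _ => hab⟩
  choose b a hab using hex
  refine h ⟨fun s j => ↑(fun i => b i s j), fun s j => ↑(fun i => a i s j), fun s j => ?_⟩
  refine (realize_sumElim_product_cast φ (fun i => a i j) (fun i => b i s)).trans ?_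
  constructor
  · intro hr
    obtain ⟨i, hi, hri⟩ := (hcon.and hr).exists
    exact (hab i hi s j).1 hri
  · exact fun hj => hcon.mono fun i hi => (hab i hi s j).2 hj

end Ultraproduct

/-- If the ultraproduct `ℳ = ∏_D M i` is NIP, then every pseudo-finite
Keisler measure over `ℳ` (in the tuple of variables `x` of length `p`) is finitely
approximated. -/
theorem pseudoFinite_finitelyApproximated_of_NIP
    {L : FirstOrder.Language} {I : Type*} {M : I → Type v} [∀ i, L.Structure (M i)]
    (D : Ultrafilter I)
    (hNIP : IsNIPStructure L ((D : Filter I).Product M))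
    (p : ℕ) (μ : KeislerMeasure L ((D : Filter I).Product M) (Fin p))
    (hpf : μ.PseudoFinite D) :
    μ.FinitelyApproximated := by
  rcases isEmpty_or_nonempty ((D : Filter I).Product M) with hE | hne
  · exact μ.finitelyApproximated_of_subsingleton
  have : ∀ i, Nonempty (M i) := fun i => hne.elim fun q => Quotient.inductionOn q fun f => ⟨f i⟩
  intro n φ ε hε
  obtain ⟨μi, hconv, hlim⟩ := hpf
  obtain ⟨k, hk⟩ := hNIP.exists_shattersNo φ
  obtain ⟨N, hN, happrox⟩ := exists_forall_isConvComb_approx k (show 0 < ε / 3 by positivity)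
  have hex : ∀ i, ∃ as : Fin N → (Fin p → M i), ShattersNo (M i) φ k →
      ∀ b : Fin n → M i, |(μi i).toFun n φ b - KeislerAvg as n φ b| ≤ ε / 3 := by
    intro i
    by_cases hi : ShattersNo (M i) φ k
    · obtain ⟨as, has⟩ := happrox hi (hconv i)
      exact ⟨as, fun _ => has⟩
    · exact ⟨fun _ _ => Classical.arbitrary _, fun h => absurd h hi⟩
  choose as has using hex
  refine ⟨N, fun l j => ↑(fun i => as i l j), hN, fun b => ?_⟩
  obtain ⟨c, rfl⟩ : ∃ c : ∀ i, Fin n → M i,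
      b = fun j => (↑(fun i => c i j) : (D : Filter I).Product M) := by
    choose c hc using fun j => Quotient.exists_rep (b j)
    exact ⟨fun i j => c j i, funext fun j => (hc j).symm⟩
  have hagree : ∀ᶠ i in (D : Filter I), ∀ l : Fin N,
      φ.Realize (Sum.elim (fun j => (↑(fun i => as i l j) : (D : Filter I).Product M))
        (fun j => (↑(fun i => c i j) : (D : Filter I).Product M))) ↔
      φ.Realize (Sum.elim (as i l) (c i)) := by
    refine Filter.eventually_all.2 fun l => ?_
    by_cases hl : ∀ᶠ i in (D : Filter I), φ.Realize (Sum.elim (as i l) (c i))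
    · filter_upwards [hl] with i hi
      exact iff_of_true ((realize_sumElim_product_cast φ (fun i => as i l) c).2 hl) hi
    · filter_upwards [Ultrafilter.eventually_not.2 hl] with i hi
      exact iff_of_false (fun h => hl ((realize_sumElim_product_cast φ (fun i => as i l) c).1 h)) hi
  have hclose : ∀ᶠ i in (D : Filter I), |(μi i).toFun n φ (c i) - _| ≤ ε / 3 :=
    hlim n φ c (ε / 3) (by positivity)
  obtain ⟨i, ⟨hi, hci⟩, hsi⟩ := ((hagree.and hclose).and hk.eventually).exists
  have havg : KeislerAvg (fun l j => (↑(fun i => as i l j) : (D : Filter I).Product M)) n φ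
      (fun j => (↑(fun i => c i j) : (D : Filter I).Product M)) = KeislerAvg (as i) n φ (c i) := by
    simp only [KeislerAvg, hi]
  refine (congrArg (fun z => |_ - z|) havg).trans_lt ?_
  have h1 := abs_le.1 (has i hsi (c i))
  have h2 := abs_le.1 hci
  rw [abs_lt]
  constructor <;> linarith
end

section
/- Let (M_i)_{i∈I} be L-structures, D an ultrafilter on I, and ℳ = ∏_D M_i. For each i ∈ I, let μ¹_i, μ²_i ∈ conv_x(M_i) and ν¹_i, ν²_i ∈ conv_y(M_i). Suppose that lim_D μ¹_i = lim_D μ²_i (as Keisler measures over ℳ in variable x) and lim_D ν¹_i = lim_D ν²_i (in variable y). Then lim_D (μ¹_i ⊗ ν¹_i) = lim_D (μ²_i ⊗ ν²_i) as Keisler measures over ℳ in the variables xy; that is, the pseudo-finite product ⊠ is well-defined, independent of the choice of approximating families. -/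
open FirstOrder FirstOrder.Language

attribute [local instance] Classical.propDecidable

universe u v w

variable {L : FirstOrder.Language}

/-- The value of the convex combination `Σ_j r_j δ_{a_j} ∈ conv_β(N)` of Dirac measures on the
formula `φ(x, c)` (with `x` indexed by `β`). -/
noncomputable def convVal {N : Type*} [L.Structure N] {β : Type*} {m : ℕ}
    (r : Fin m → ℝ) (a : Fin m → (β → N)) (n : ℕ)
    (φ : L.Formula (β ⊕ Fin n)) (c : Fin n → N) : ℝ :=
  ∑ j, if φ.Realize (Sum.elim (a j) c) then r j else 0

/-- The value of the product `(Σ_k r_k δ_{a_k}) ⊗ (Σ_j s_j δ_{b_j}) = Σ_{k,j} r_k s_j δ_{(a_k,b_j)}`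
of two convex combinations of Dirac measures on the formula `θ(x, y, c)` (with `x` indexed by
`β₁` and `y` by `β₂`). -/
noncomputable def convProdVal {N : Type*} [L.Structure N] {β₁ β₂ : Type*} {m₁ m₂ : ℕ}
    (r : Fin m₁ → ℝ) (a : Fin m₁ → (β₁ → N)) (s : Fin m₂ → ℝ) (b : Fin m₂ → (β₂ → N))
    (n : ℕ) (θ : L.Formula ((β₁ ⊕ β₂) ⊕ Fin n)) (c : Fin n → N) : ℝ :=
  ∑ k, ∑ j, if θ.Realize (Sum.elim (Sum.elim (a k) (b j)) c) then r k * s j else 0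

/-- A formula depends on only finitely many of the variables in `δ`, so these can be indexed by
some `Fin m`. -/
theorem exists_formula_fin_params {β δ : Type*} (θ : L.Formula (β ⊕ δ)) :
    ∃ (m : ℕ) (g : Fin m → δ) (ψ : L.Formula (β ⊕ Fin m)),
      ∀ (N : Type v) [L.Structure N] (y : β → N) (d : δ → N),
        ψ.Realize (Sum.elim y (d ∘ g)) ↔ θ.Realize (Sum.elim y d) := by
  let S : Finset δ := θ.freeVarFinset.toRight
  let e := S.equivFin
  let f : θ.freeVarFinset → β ⊕ Fin S.card := fun z =>
    match z with
    | ⟨Sum.inl b, _⟩ => Sum.inl b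
    | ⟨Sum.inr x, h⟩ => Sum.inr (e ⟨x, Finset.mem_toRight.2 h⟩)
  refine ⟨S.card, fun k => (e.symm k : δ), BoundedFormula.restrictFreeVar θ f, ?_⟩
  intro N _ y d
  refine BoundedFormula.realize_restrictFreeVar _ ?_
  rintro ⟨b | x, h⟩ <;> simp [f]

/-- The value of `Σ_j r_j δ_{a_j}` on `θ(x, d)`, with parameters indexed by an arbitrary type. -/
noncomputable def convEval {N : Type*} [L.Structure N] {β δ : Type*} {m : ℕ}
    (r : Fin m → ℝ) (a : Fin m → (β → N)) (θ : L.Formula (β ⊕ δ)) (d : δ → N) : ℝ :=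
  ∑ j, if θ.Realize (Sum.elim (a j) d) then r j else 0

theorem convEval_mem_Icc {N : Type*} [L.Structure N] {β δ : Type*} {m : ℕ}
    {r : Fin m → ℝ} (hr : ∀ j, 0 < r j) (hsum : ∑ j, r j = 1) (a : Fin m → (β → N))
    (θ : L.Formula (β ⊕ δ)) (d : δ → N) : convEval r a θ d ∈ Set.Icc (0 : ℝ) 1 := by
  constructor
  · refine Finset.sum_nonneg fun j _ => ?_
    split_ifs
    exacts [(hr j).le, le_rfl]
  · rw [← hsum]
    refine Finset.sum_le_sum fun j _ => ?_
    split_ifs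
    exacts [le_rfl, (hr j).le]

theorem exists_isDLim_of_mem_Icc {I : Type*} (D : Ultrafilter I) {f : I → ℝ} {a b : ℝ}
    (hf : ∀ i, f i ∈ Set.Icc a b) : ∃ t, IsDLim D f t := by
  obtain ⟨t, -, ht⟩ := (isCompact_Icc (a := a) (b := b)).ultrafilter_le_nhds (D.map f)
    (Filter.tendsto_principal.2 (Filter.Eventually.of_forall hf))
  exact ⟨t, fun ε hε => ht (Metric.closedBall_mem_nhds t hε)⟩

theorem IsDLim.of_abs_sub_le {I : Type*} {D : Ultrafilter I} {f g : I → ℝ} {t : ℝ}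
    (hf : IsDLim D f t) (hfg : ∀ ε : ℝ, 0 < ε → {i | |f i - g i| ≤ ε} ∈ D) : IsDLim D g t := by
  intro ε hε
  filter_upwards [hf (ε / 2) (half_pos hε), hfg (ε / 2) (half_pos hε)] with i h₁ h₂
  simp only [abs_le] at *
  constructor <;> linarith [h₁.1, h₁.2, h₂.1, h₂.2]

/-- If two families of convex combinations have the same limit Keisler measure, then their values
on the instances of a fixed formula are uniformly close along the ultrafilter. -/
theorem eventually_forall_abs_convEval_sub_le
    {I : Type*} {M : I → Type v} [∀ i, L.Structure (M i)] (D : Ultrafilter I)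
    {β δ : Type*} {l₁ l₂ : I → ℕ}
    {s₁ : ∀ i, Fin (l₁ i) → ℝ} {b₁ : ∀ i, Fin (l₁ i) → (β → M i)}
    {s₂ : ∀ i, Fin (l₂ i) → ℝ} {b₂ : ∀ i, Fin (l₂ i) → (β → M i)}
    (hs₁ : ∀ i j, 0 < s₁ i j) (hs₁sum : ∀ i, ∑ j, s₁ i j = 1)
    (hν : ∀ (n : ℕ) (ψ : L.Formula (β ⊕ Fin n)) (c : ∀ i, Fin n → M i) (t : ℝ),
      IsDLim D (fun i => convVal (s₁ i) (b₁ i) n ψ (c i)) t ↔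
        IsDLim D (fun i => convVal (s₂ i) (b₂ i) n ψ (c i)) t)
    (θ : L.Formula (β ⊕ δ)) (d₀ : ∀ i, δ → M i) {ε : ℝ} (hε : 0 < ε) :
    {i | ∀ d : δ → M i,
      |convEval (s₁ i) (b₁ i) θ d - convEval (s₂ i) (b₂ i) θ d| ≤ ε} ∈ D := by
  have hd : ∀ i, ∃ d : δ → M i,
      |convEval (s₁ i) (b₁ i) θ d - convEval (s₂ i) (b₂ i) θ d| ≤ ε → ∀ d : δ → M i,
        |convEval (s₁ i) (b₁ i) θ d - convEval (s₂ i) (b₂ i) θ d| ≤ ε := by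
    intro i
    by_contra! h
    obtain ⟨-, d, hd⟩ := h (d₀ i)
    exact absurd (h d).1 hd.not_ge
  choose d hd using hd
  obtain ⟨m, g, ψ, hψ⟩ := exists_formula_fin_params.{v} θ
  have h₁ : ∀ i, convVal (s₁ i) (b₁ i) m ψ (d i ∘ g) = convEval (s₁ i) (b₁ i) θ (d i) :=
    fun i => by simp only [convVal, convEval, hψ]
  have h₂ : ∀ i, convVal (s₂ i) (b₂ i) m ψ (d i ∘ g) = convEval (s₂ i) (b₂ i) θ (d i) :=
    fun i => by simp only [convVal, convEval, hψ]
  have key := hν m ψ fun i => d i ∘ g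
  simp only [h₁, h₂] at key
  obtain ⟨t, ht⟩ := exists_isDLim_of_mem_Icc D
    fun i => convEval_mem_Icc (hs₁ i) (hs₁sum i) (b₁ i) θ (d i)
  filter_upwards [ht (ε / 2) (half_pos hε), (key t).1 ht (ε / 2) (half_pos hε)] with i hi₁ hi₂
  refine hd i ?_
  simp only [abs_le] at *
  constructor <;> linarith [hi₁.1, hi₁.2, hi₂.1, hi₂.2]

theorem abs_sum_mul_sub_sum_mul_le {ι : Type*} [Fintype ι] {r f g : ι → ℝ} {ε : ℝ}
    (hr : ∀ k, 0 < r k) (hsum : ∑ k, r k = 1) (h : ∀ k, |f k - g k| ≤ ε) :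
    |∑ k, r k * f k - ∑ k, r k * g k| ≤ ε := by
  calc |∑ k, r k * f k - ∑ k, r k * g k| = |∑ k, r k * (f k - g k)| := by
        simp only [mul_sub, Finset.sum_sub_distrib]
    _ ≤ ∑ k, |r k * (f k - g k)| := Finset.abs_sum_le_sum_abs _ _
    _ ≤ ∑ k, r k * ε := Finset.sum_le_sum fun k _ => by
        rw [abs_mul, abs_of_pos (hr k)]
        exact mul_le_mul_of_nonneg_left (h k) (hr k).le
    _ = ε := by rw [← Finset.sum_mul, hsum, one_mul]

section Product

variable {N : Type*} [L.Structure N] {α β : Type*} {m l n : ℕ}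
  (r : Fin m → ℝ) (a : Fin m → (α → N)) (s : Fin l → ℝ) (b : Fin l → (β → N))
  (θ : L.Formula ((α ⊕ β) ⊕ Fin n)) (c : Fin n → N)

theorem convProdVal_eq_sum_left :
    convProdVal r a s b n θ c = ∑ k, r k * convEval s b
      (θ.relabel (Sum.elim (Sum.elim (Sum.inr ∘ Sum.inl) Sum.inl) (Sum.inr ∘ Sum.inr)) :
        L.Formula (β ⊕ (α ⊕ Fin n))) (Sum.elim (a k) c) := by
  simp only [convProdVal, convEval, Finset.mul_sum, mul_ite, mul_zero, Formula.realize_relabel,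
    Sum.comp_elim, ← Function.comp_assoc, Sum.elim_comp_inr, Sum.elim_comp_inl]

theorem convProdVal_eq_sum_right :
    convProdVal r a s b n θ c = ∑ j, s j * convEval r a
      (θ.relabel (Sum.elim (Sum.elim Sum.inl (Sum.inr ∘ Sum.inl)) (Sum.inr ∘ Sum.inr)) :
        L.Formula (α ⊕ (β ⊕ Fin n))) (Sum.elim (b j) c) := by
  simp only [convProdVal, convEval, Finset.mul_sum, mul_ite, mul_zero, Formula.realize_relabel,
    Sum.comp_elim, ← Function.comp_assoc, Sum.elim_comp_inr, Sum.elim_comp_inl]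
  rw [Finset.sum_comm]
  simp only [mul_comm]

end Product

/-- The pseudo-finite product is well-defined: if `μ¹_i, μ²_i ∈ conv_x(M_i)`
and `ν¹_i, ν²_i ∈ conv_y(M_i)` are families of convex combinations of Dirac measures with
`lim_D μ¹_i = lim_D μ²_i` and `lim_D ν¹_i = lim_D ν²_i` as Keisler measures over the
ultraproduct (i.e. the `D`-limits of their values agree on every formula and every family of
representatives of parameters from the ultraproduct), then
`lim_D (μ¹_i ⊗ ν¹_i) = lim_D (μ²_i ⊗ ν²_i)` as Keisler measures over the ultraproduct in the
variables `xy`. -/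
theorem pseudoFinite_product_wellDefined
    {I : Type*} {M : I → Type v} [∀ i, L.Structure (M i)] (D : Ultrafilter I)
    {α β : Type*}
    (m₁ m₂ : I → ℕ) (l₁ l₂ : I → ℕ)
    (r₁ : ∀ i, Fin (m₁ i) → ℝ) (a₁ : ∀ i, Fin (m₁ i) → (α → M i))
    (r₂ : ∀ i, Fin (m₂ i) → ℝ) (a₂ : ∀ i, Fin (m₂ i) → (α → M i))
    (s₁ : ∀ i, Fin (l₁ i) → ℝ) (b₁ : ∀ i, Fin (l₁ i) → (β → M i))
    (s₂ : ∀ i, Fin (l₂ i) → ℝ) (b₂ : ∀ i, Fin (l₂ i) → (β → M i))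
    (hr₁ : ∀ i j, 0 < r₁ i j) (hr₁sum : ∀ i, ∑ j, r₁ i j = 1)
    (hr₂ : ∀ i j, 0 < r₂ i j) (hr₂sum : ∀ i, ∑ j, r₂ i j = 1)
    (hs₁ : ∀ i j, 0 < s₁ i j) (hs₁sum : ∀ i, ∑ j, s₁ i j = 1)
    (hs₂ : ∀ i j, 0 < s₂ i j) (hs₂sum : ∀ i, ∑ j, s₂ i j = 1)
    -- `lim_D μ¹_i = lim_D μ²_i` as Keisler measures over the ultraproduct:
    (hμ : ∀ (n : ℕ) (φ : L.Formula (α ⊕ Fin n)) (c : ∀ i, Fin n → M i) (t : ℝ),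
      IsDLim D (fun i => convVal (r₁ i) (a₁ i) n φ (c i)) t ↔
        IsDLim D (fun i => convVal (r₂ i) (a₂ i) n φ (c i)) t)
    -- `lim_D ν¹_i = lim_D ν²_i` as Keisler measures over the ultraproduct:
    (hν : ∀ (n : ℕ) (ψ : L.Formula (β ⊕ Fin n)) (c : ∀ i, Fin n → M i) (t : ℝ),
      IsDLim D (fun i => convVal (s₁ i) (b₁ i) n ψ (c i)) t ↔
        IsDLim D (fun i => convVal (s₂ i) (b₂ i) n ψ (c i)) t) :
    -- `lim_D (μ¹_i ⊗ ν¹_i) = lim_D (μ²_i ⊗ ν²_i)` over the ultraproduct: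
    ∀ (n : ℕ) (θ : L.Formula ((α ⊕ β) ⊕ Fin n)) (c : ∀ i, Fin n → M i) (t : ℝ),
      IsDLim D (fun i => convProdVal (r₁ i) (a₁ i) (s₁ i) (b₁ i) n θ (c i)) t ↔
        IsDLim D (fun i => convProdVal (r₂ i) (a₂ i) (s₂ i) (b₂ i) n θ (c i)) t := by
  intro n θ c t
  have exists_index : ∀ {m : ℕ} {r : Fin m → ℝ}, ∑ j, r j = 1 → Nonempty (Fin m) := by
    intro m r h
    by_contra hm
    rw [not_nonempty_iff] at hm
    simp at h
  have x₀ : ∀ i, Nonempty (α → M i) := fun i => (exists_index (hr₁sum i)).map (a₁ i)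
  have y₀ : ∀ i, Nonempty (β → M i) := fun i => (exists_index (hs₁sum i)).map (b₁ i)
  have close : ∀ ε : ℝ, 0 < ε → {i | |convProdVal (r₁ i) (a₁ i) (s₁ i) (b₁ i) n θ (c i) -
      convProdVal (r₂ i) (a₂ i) (s₂ i) (b₂ i) n θ (c i)| ≤ ε} ∈ D := by
    intro ε hε
    filter_upwards [
      eventually_forall_abs_convEval_sub_le D hs₁ hs₁sum hν
        (θ.relabel (Sum.elim (Sum.elim (Sum.inr ∘ Sum.inl) Sum.inl) (Sum.inr ∘ Sum.inr)) :
          L.Formula (β ⊕ (α ⊕ Fin n))) (fun i => Sum.elim (x₀ i).some (c i)) (half_pos hε),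
      eventually_forall_abs_convEval_sub_le D hr₁ hr₁sum hμ
        (θ.relabel (Sum.elim (Sum.elim Sum.inl (Sum.inr ∘ Sum.inl)) (Sum.inr ∘ Sum.inr)) :
          L.Formula (α ⊕ (β ⊕ Fin n))) (fun i => Sum.elim (y₀ i).some (c i)) (half_pos hε)]
      with i hi₁ hi₂
    have h₁ := abs_sum_mul_sub_sum_mul_le (hr₁ i) (hr₁sum i)
      fun k => hi₁ (Sum.elim (a₁ i k) (c i))
    have h₂ := abs_sum_mul_sub_sum_mul_le (hs₂ i) (hs₂sum i)
      fun j => hi₂ (Sum.elim (b₂ i j) (c i))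
    rw [← convProdVal_eq_sum_left, ← convProdVal_eq_sum_left] at h₁
    rw [← convProdVal_eq_sum_right, ← convProdVal_eq_sum_right] at h₂
    calc _ ≤ _ := abs_sub_le _ _ _
      _ ≤ ε / 2 + ε / 2 := add_le_add h₁ h₂
      _ = ε := add_halves ε
  exact ⟨fun h => h.of_abs_sub_le close,
    fun h => h.of_abs_sub_le fun ε hε => by simpa only [abs_sub_comm] using close ε hε⟩
end

section
/- Let (q_i)_{i∈ℕ} enumerate the primes congruent to 1 mod 4, let D be a non-principal ultrafilter on ℕ, and let ℳ = ∏_D G_{q_i} be the ultraproduct of the Paley graphs, with edge relation R. Let ν be a Keisler measure over ℳ in one variable x such that for some real r ≠ 1/2, ν(R(x,𝐚)) = r for every 𝐚 ∈ ℳ. Then ν is not pseudo-finite with respect to (G_{q_i})_{i∈ℕ} and D. In particular, every unfairly weighted coin-flipping measure ν_p with p ∈ [0,1] \ {1/2} is not pseudo-finite in this context. -/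
open FirstOrder FirstOrder.Language

attribute [local instance] Classical.propDecidable

universe u v w

variable {L : FirstOrder.Language} {M : Type*} [L.Structure M] {α : Type*}

/-- The Paley graph structure on `F_q` in the language of graphs: `a` and `b` are adjacent iff
they are distinct and `a - b` is a square. -/
def paleyStructure (q : ℕ) : Language.graph.Structure (ZMod q) where
  RelMap | .adj => fun x => x 0 ≠ x 1 ∧ ∃ z : ZMod q, z ^ 2 = x 0 - x 1

attribute [local instance] paleyStructure

/-- The graph-language formula `R(x, y)` with a single variable `x` and a single parameter
variable `y`. -/
def edgeFormula : Language.graph.Formula (Fin 1 ⊕ Fin 1) :=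
  Language.adj.formula₂ (Term.var (Sum.inl 0)) (Term.var (Sum.inr 0))

/-- Every vertex of the Paley graph on `F_q`, `q` an odd prime, has `(q - 1) / 2` neighbours. -/
theorem sum_paley_adj {q : ℕ} [Fact q.Prime] (h2 : q ≠ 2) (x : ZMod q) :
    ∑ a : ZMod q, (if x ≠ a ∧ ∃ z : ZMod q, z ^ 2 = x - a then (1 : ℝ) else 0)
      = ((q : ℝ) - 1) / 2 := by
  have key : ∀ a : ZMod q, (if x ≠ a ∧ ∃ z : ZMod q, z ^ 2 = x - a then (1 : ℝ) else 0)
      = (1 + ((quadraticChar (ZMod q) (x - a) : ℤ) : ℝ) - if x = a then 1 else 0) / 2 := by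
    intro a
    by_cases h : x = a
    · simp [h]
    · have h0 : x - a ≠ 0 := sub_ne_zero.mpr h
      by_cases hs : IsSquare (x - a)
      · have h1 := (quadraticChar_one_iff_isSquare h0).mpr hs
        have hz : ∃ z : ZMod q, z ^ 2 = x - a := by
          obtain ⟨z, hz⟩ := hs
          exact ⟨z, by rw [hz, sq]⟩
        rw [if_pos ⟨h, hz⟩, h1, if_neg h]
        norm_num
      · have h1 := quadraticChar_neg_one_iff_not_isSquare.mpr hs
        have hz : ¬ ∃ z : ZMod q, z ^ 2 = x - a := by
          rintro ⟨z, hz⟩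
          exact hs ⟨z, by rw [← hz, sq]⟩
        rw [if_neg (fun H => hz H.2), h1, if_neg h]
        norm_num
  have hchar : ∑ a : ZMod q, quadraticChar (ZMod q) (x - a) = 0 := by
    refine ((Equiv.subLeft x).sum_comp (fun a => quadraticChar (ZMod q) a)).trans ?_
    exact quadraticChar_sum_zero (by rwa [ZMod.ringChar_zmod_n])
  have hchar' : ∑ a : ZMod q, ((quadraticChar (ZMod q) (x - a) : ℤ) : ℝ) = 0 := by
    exact_mod_cast hchar
  rw [Finset.sum_congr rfl fun a _ => key a, ← Finset.sum_div, Finset.sum_sub_distrib,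
    Finset.sum_add_distrib, hchar']
  simp [ZMod.card]

theorem realize_edgeFormula {q : ℕ} (x b : Fin 1 → ZMod q) :
    edgeFormula.Realize (Sum.elim x b) ↔ x 0 ≠ b 0 ∧ ∃ z : ZMod q, z ^ 2 = x 0 - b 0 := by
  rw [edgeFormula, Formula.realize_rel₂]
  rfl

/-- The values of a convex combination of Dirac measures on the edge instances of the Paley graph
have mean `(q - 1) / (2 * q)`. -/
theorem KeislerMeasure.IsConvComb.sum_edgeFormula {q : ℕ} [Fact q.Prime] (h2 : q ≠ 2)
    {μ : KeislerMeasure Language.graph (ZMod q) (Fin 1)} (hμ : μ.IsConvComb) :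
    ∑ a : ZMod q, μ.toFun 1 edgeFormula (fun _ => a) = ((q : ℝ) - 1) / 2 := by
  obtain ⟨m, r, x, -, hsum, hval⟩ := hμ
  simp_rw [hval, realize_edgeFormula]
  rw [Finset.sum_comm]
  have key : ∀ j, ∑ a : ZMod q,
      (if x j 0 ≠ a ∧ ∃ z : ZMod q, z ^ 2 = x j 0 - a then r j else 0)
        = r j * (((q : ℝ) - 1) / 2) := by
    intro j
    rw [← sum_paley_adj h2 (x j 0), Finset.mul_sum]
    simp only [mul_ite, mul_one, mul_zero]
  rw [Finset.sum_congr rfl fun j _ => key j, ← Finset.sum_mul, hsum, one_mul]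

theorem KeislerMeasure.IsConvComb.exists_edgeFormula_le_half {q : ℕ} [Fact q.Prime] (h2 : q ≠ 2)
    {μ : KeislerMeasure Language.graph (ZMod q) (Fin 1)} (hμ : μ.IsConvComb) :
    ∃ a : ZMod q, μ.toFun 1 edgeFormula (fun _ => a) ≤ 1 / 2 := by
  by_contra! h
  have := Finset.sum_le_sum fun a (_ : a ∈ Finset.univ) => (h a).le
  rw [hμ.sum_edgeFormula h2] at this
  simp [ZMod.card] at this
  linarith

theorem KeislerMeasure.IsConvComb.exists_le_edgeFormula {q : ℕ} [Fact q.Prime] (h2 : q ≠ 2)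
    {μ : KeislerMeasure Language.graph (ZMod q) (Fin 1)} (hμ : μ.IsConvComb) :
    ∃ a : ZMod q, 1 / 2 - 1 / (2 * (q : ℝ)) ≤ μ.toFun 1 edgeFormula (fun _ => a) := by
  by_contra! h
  have := Finset.sum_lt_sum_of_nonempty Finset.univ_nonempty
    fun a (_ : a ∈ Finset.univ) => h a
  rw [hμ.sum_edgeFormula h2, Finset.sum_const, Finset.card_univ, ZMod.card, nsmul_eq_mul] at this
  have hq : (q : ℝ) ≠ 0 := Nat.cast_ne_zero.mpr (Fact.out : q.Prime).ne_zero
  refine this.ne ?_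
  field_simp

/-- Let `(q i)` enumerate the primes `≡ 1 (mod 4)`, `D` a non-principal
ultrafilter on `ℕ`, and `ℳ = ∏_D G_{q i}` the ultraproduct of the Paley graphs. Any Keisler
measure `ν` over `ℳ` in one variable giving every edge-instance `R(x, 𝐚)` a constant value
`r ≠ 1/2` is not pseudo-finite with respect to `(G_{q i})` and `D`. In particular, the
unfairly weighted coin-flipping measures (which satisfy `ν_p(R(x, 𝐚)) = p ≠ 1/2` for all `𝐚`)
are not pseudo-finite in this context. -/
theorem unfair_measure_not_pseudoFinite
    (q : ℕ → ℕ) (hq : ∀ i, (q i).Prime ∧ q i % 4 = 1)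
    (hmono : StrictMono q)
    (henum : ∀ p : ℕ, (p.Prime ∧ p % 4 = 1) ↔ ∃ i, q i = p)
    (D : Ultrafilter ℕ) (hD : ∀ i : ℕ, D ≠ pure i)
    (ν : KeislerMeasure Language.graph ((D : Filter ℕ).Product (fun i => ZMod (q i))) (Fin 1))
    (r : ℝ) (hr : r ≠ 1 / 2)
    (hν : ∀ A : (D : Filter ℕ).Product (fun i => ZMod (q i)),
      ν.toFun 1 edgeFormula (fun _ => A) = r) :
    ¬ ν.PseudoFinite D := by
  rintro ⟨μ, hconv, hlim⟩
  have hprime : ∀ i, Fact (q i).Prime := fun i => ⟨(hq i).1⟩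
  have h2 : ∀ i, q i ≠ 2 := fun i h => by
    have := (hq i).2
    omega
  have hlim' : ∀ a : ∀ i, ZMod (q i),
      IsDLim D (fun i => (μ i).toFun 1 edgeFormula (fun _ => a i)) r := by
    intro a
    rw [← hν (↑a : (D : Filter ℕ).Product fun i => ZMod (q i))]
    exact hlim 1 edgeFormula (fun i _ => a i)
  rcases lt_or_gt_of_ne hr with hlt | hgt
  · choose a ha using fun i => (hconv i).exists_le_edgeFormula (h2 i)
    have hcof : (D : Filter ℕ) ≤ Filter.atTop := by
      rw [← Nat.cofinite_eq_atTop]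
      exact D.le_cofinite_or_eq_pure.resolve_right fun ⟨i, hi⟩ => hD i hi
    have htend : Filter.Tendsto (fun i => (q i : ℝ)) D Filter.atTop :=
      (tendsto_natCast_atTop_atTop.comp hmono.tendsto_atTop).mono_left hcof
    have hev := htend.eventually_gt_atTop (1 / (1 / 2 - r))
    obtain ⟨i, hi, hqi⟩ :=
      (Filter.Eventually.and (hlim' a ((1 / 2 - r) / 2) (by linarith)) hev).exists
    have hpos : (0 : ℝ) < q i := Nat.cast_pos.mpr (hq i).1.pos
    have hi' := (abs_le.mp hi).2
    have hai := ha i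
    rw [div_lt_comm₀ (by linarith) hpos] at hqi
    have : 1 / (2 * (q i : ℝ)) = 1 / (q i : ℝ) / 2 := by field_simp
    linarith
  · choose a ha using fun i => (hconv i).exists_edgeFormula_le_half (h2 i)
    obtain ⟨i, hi⟩ := (Filter.Eventually.exists (f := (D : Filter ℕ))
      (hlim' a ((r - 1 / 2) / 2) (by linarith)))
    have hi' := (abs_le.mp hi).1
    have hai := ha i
    linarith
end

section
/- Let (q_i)_{i∈ℕ} enumerate the primes congruent to 1 mod 4, let D be a non-principal ultrafilter on ℕ, and let ℳ = ∏_D G_{q_i} be the ultraproduct of the Paley graphs, with edge relation R. Then ℳ is a model of the theory of the random graph: R is irreflexive and symmetric on ℳ, and for any two disjoint finite subsets A and B of ℳ there exists 𝐯 ∈ ℳ with 𝐯 ∉ A ∪ B such that R(𝐯, 𝐚) holds for every 𝐚 ∈ A and R(𝐯, 𝐛) fails for every 𝐛 ∈ B. -/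
open FirstOrder FirstOrder.Language FirstOrder.Language.Structure

attribute [local instance] paleyStructure

open Polynomial in
/-- The operator `h ↦ c f' h + f h'`, which satisfies
`(f ^ (n + 1) * h)' = f ^ n * weightedDerivative f (n + 1) h`. -/
noncomputable def weightedDerivative {K : Type*} [CommRing K] (f : K[X]) (c : K) :
    K[X] →ₗ[K] K[X] :=
  c • LinearMap.mulLeft K (derivative f) + LinearMap.mulLeft K f ∘ₗ derivative

open Polynomial in
/-- The cofactor of `f ^ (N - i)` in the `i`-th derivative of `f ^ N * h`, as a linear function
of `h`. -/
noncomputable def derivativeCofactor {K : Type*} [CommRing K] (f : K[X]) (N : ℕ) :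
    ℕ → (K[X] →ₗ[K] K[X])
  | 0 => LinearMap.id
  | i + 1 => weightedDerivative f ((N : K) - i) ∘ₗ derivativeCofactor f N i

section DerivativeCofactor

open Polynomial

variable {K : Type*} [CommRing K]

lemma weightedDerivative_apply (f : K[X]) (c : K) (h : K[X]) :
    weightedDerivative f c h = C c * (derivative f * h) + f * derivative h := by
  simp [weightedDerivative, smul_eq_C_mul]

lemma iterate_derivative_pow_mul (f : K[X]) (N i : ℕ) (hi : i ≤ N) (h : K[X]) :
    derivative^[i] (f ^ N * h) = f ^ (N - i) * derivativeCofactor f N i h := by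
  induction i with
  | zero => simp [derivativeCofactor]
  | succ i ih =>
    obtain ⟨k, rfl⟩ := Nat.exists_eq_add_of_le hi
    rw [Function.iterate_succ_apply', ih (by omega), derivativeCofactor, LinearMap.comp_apply,
      weightedDerivative_apply, show i + 1 + k - i = k + 1 by omega,
      show i + 1 + k - (i + 1) = k by omega, derivative_mul, derivative_pow_succ]
    have : (((i + 1 + k : ℕ) : K) - i) = k + 1 := by push_cast; ring
    rw [this]
    ring

lemma derivativeCofactor_mul_of_derivative_eq_zero (f : K[X]) (N i : ℕ) (h w : K[X])
    (hw : derivative w = 0) :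
    derivativeCofactor f N i (h * w) = derivativeCofactor f N i h * w := by
  induction i with
  | zero => simp [derivativeCofactor]
  | succ i ih =>
    simp only [derivativeCofactor, LinearMap.comp_apply, ih, weightedDerivative_apply,
      derivative_mul, hw]
    ring

lemma natDegree_derivativeCofactor_le (f : K[X]) (N i : ℕ) (h : K[X]) :
    (derivativeCofactor f N i h).natDegree ≤ h.natDegree + i * f.natDegree := by
  induction i with
  | zero => simp [derivativeCofactor]
  | succ i ih =>
    simp only [derivativeCofactor, LinearMap.comp_apply, weightedDerivative_apply]
    set u := derivativeCofactor f N i h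
    have h₁ : (derivative f).natDegree ≤ f.natDegree := (natDegree_derivative_le f).trans (by omega)
    have h₂ : (derivative u).natDegree ≤ u.natDegree := (natDegree_derivative_le u).trans (by omega)
    rw [add_mul, one_mul]
    refine natDegree_add_le_of_degree_le ?_ ?_
    · refine (natDegree_C_mul_le _ _).trans (natDegree_mul_le.trans ?_)
      omega
    · refine natDegree_mul_le.trans ?_
      omega

end DerivativeCofactor

section Stepanov

open Polynomial

variable {p : ℕ} [Fact p.Prime]

/-- If `f` has a simple root then `a² f = c b²` with `c` constant forces `a = b = 0`. -/
lemma eq_zero_of_sq_mul_eq_C_mul_sq {K : Type*} [Field K] {f a b : K[X]} {c x : K}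
    (hc : c ≠ 0) (hx : f.rootMultiplicity x = 1) (h : a ^ 2 * f = C c * b ^ 2) :
    a = 0 ∧ b = 0 := by
  have hf : f ≠ 0 := by rintro rfl; simp at hx
  have hC : C c ≠ 0 := by simpa
  by_cases ha : a = 0
  · subst ha
    simpa [hC, eq_comm] using h
  have hb : b ≠ 0 := by
    rintro rfl
    simp [ha, hf] at h
  have := congrArg (rootMultiplicity x) h
  rw [rootMultiplicity_mul (by simp [ha, hf]), rootMultiplicity_mul (by simp [hc, hb]), pow_two,
    pow_two, rootMultiplicity_mul (by simp [ha]), rootMultiplicity_mul (by simp [hb]),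
    rootMultiplicity_C, hx] at this
  omega

lemma eq_zero_of_sum_add_pow_mul_sum_eq_zero (hp : p ≠ 2) {f : (ZMod p)[X]} {x : ZMod p}
    (hx : f.rootMultiplicity x = 1) (h0 : f.coeff 0 ≠ 0) {n : ℕ} (hn : 2 * n + f.natDegree < p)
    {J : ℕ} (P Q : Fin J → (ZMod p)[X]) (hP : ∀ j, (P j).natDegree ≤ n)
    (hQ : ∀ j, (Q j).natDegree ≤ n)
    (h : ∑ j, P j * X ^ ((j : ℕ) * p) + f ^ (p / 2) * ∑ j, Q j * X ^ ((j : ℕ) * p) = 0) :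
    ∀ j, P j = 0 ∧ Q j = 0 := by
  induction J with
  | zero => exact fun j => j.elim0
  | succ J ih =>
    have hsplit (R : Fin (J + 1) → (ZMod p)[X]) : ∑ j, R j * X ^ ((j : ℕ) * p) =
        R 0 + X ^ p * ∑ j : Fin J, R j.succ * X ^ ((j : ℕ) * p) := by
      rw [Fin.sum_univ_succ, Finset.mul_sum]
      congr 1
      · simp
      · refine Finset.sum_congr rfl fun j _ => ?_
        rw [Fin.val_succ, add_mul, pow_add]
        ring
    rw [hsplit, hsplit] at h
    set A := ∑ j : Fin J, P j.succ * X ^ ((j : ℕ) * p)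
    set B := ∑ j : Fin J, Q j.succ * X ^ ((j : ℕ) * p)
    have hodd : 2 * (p / 2) + 1 = p := by
      have := (Fact.out : p.Prime).eq_two_or_odd
      omega
    have hg : (f ^ (p / 2)) ^ 2 * f = expand (ZMod p) p f := by
      rw [ZMod.expand_card, ← pow_mul, ← pow_succ]
      congr 1
      omega
    have hsq : (P 0 + X ^ p * A) ^ 2 * f = expand (ZMod p) p f * (Q 0 + X ^ p * B) ^ 2 := by
      rw [← hg]
      linear_combination (P 0 + X ^ p * A - f ^ (p / 2) * (Q 0 + X ^ p * B)) * f * h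
    obtain ⟨e, he⟩ : X ^ p ∣ expand (ZMod p) p f - C (f.coeff 0) := by
      obtain ⟨e, he⟩ := X_dvd_sub_C (p := f)
      refine ⟨expand (ZMod p) p e, ?_⟩
      simpa using congrArg (expand (ZMod p) p) he
    have hdvd : X ^ p ∣ P 0 ^ 2 * f - C (f.coeff 0) * Q 0 ^ 2 :=
      ⟨e * (Q 0 + X ^ p * B) ^ 2 + C (f.coeff 0) * (2 * Q 0 * B + X ^ p * B ^ 2)
        - (2 * P 0 * A + X ^ p * A ^ 2) * f, by
        linear_combination hsq + (Q 0 + X ^ p * B) ^ 2 * he⟩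
    have hz : P 0 ^ 2 * f - C (f.coeff 0) * Q 0 ^ 2 = 0 := by
      refine eq_zero_of_dvd_of_natDegree_lt hdvd ?_
      rw [natDegree_X_pow]
      refine lt_of_le_of_lt ?_ hn
      have hP0 := hP 0
      have hQ0 := hQ 0
      refine (natDegree_sub_le _ _).trans (max_le ?_ ?_)
      · refine natDegree_mul_le.trans (add_le_add (natDegree_pow_le.trans ?_) le_rfl)
        omega
      · refine (natDegree_C_mul_le _ _).trans (natDegree_pow_le.trans ?_)
        omega
    obtain ⟨hP0, hQ0⟩ := eq_zero_of_sq_mul_eq_C_mul_sq h0 hx (sub_eq_zero.1 hz)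
    have hX : (X : (ZMod p)[X]) ^ p ≠ 0 := pow_ne_zero _ X_ne_zero
    have hAB : A + f ^ (p / 2) * B = 0 := by
      refine (mul_eq_zero.1 (?_ : X ^ p * (A + f ^ (p / 2) * B) = 0)).resolve_left hX
      rw [hP0, hQ0] at h
      linear_combination h
    have := ih (fun j => P j.succ) (fun j => Q j.succ) (fun j => hP _) (fun j => hQ _) hAB
    exact fun j => Fin.cases ⟨hP0, hQ0⟩ this j

/-- The linear system whose solutions give auxiliary polynomials vanishing to high order. -/
lemma exists_ne_zero_sum_derivativeCofactor_eq_zero (f : (ZMod p)[X]) (a : ZMod p) {L n : ℕ}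
    (hL : L * (2 * L * f.natDegree + L + 1) < n) :
    ∃ h : Fin 2 × Fin (L + 1) → (ZMod p)[X], h ≠ 0 ∧ (∀ x, (h x).natDegree ≤ n) ∧
      ∀ i < 2 * L, ∑ x, C (a ^ (x.1 : ℕ)) *
        derivativeCofactor f (2 * L + x.1 * (p / 2)) i (h x) * X ^ (x.2 : ℕ) = 0 := by
  let V := Fin 2 × Fin (L + 1) → degreeLT (ZMod p) n
  let S (i : ℕ) : V →ₗ[ZMod p] (ZMod p)[X] := ∑ x : Fin 2 × Fin (L + 1),
    LinearMap.mulRight (ZMod p) (X ^ (x.2 : ℕ)) ∘ₗ LinearMap.mulLeft (ZMod p) (C (a ^ (x.1 : ℕ)))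
      ∘ₗ derivativeCofactor f (2 * L + x.1 * (p / 2)) i ∘ₗ (degreeLT (ZMod p) n).subtype ∘ₗ
      LinearMap.proj x
  have hS (i : ℕ) (v : V) : S i v = ∑ x, C (a ^ (x.1 : ℕ)) *
        derivativeCofactor f (2 * L + x.1 * (p / 2)) i (v x) * X ^ (x.2 : ℕ) := by
    simp only [S, LinearMap.sum_apply]
    rfl
  have hdeg (v : V) (x) : ((v x : degreeLT (ZMod p) n) : (ZMod p)[X]).natDegree ≤ n :=
    natDegree_le_of_degree_le (mem_degreeLT.1 (v x).2).le
  let M := n + 2 * L * f.natDegree + L + 1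
  let Φ : V →ₗ[ZMod p] (Fin (2 * L) → Fin M → ZMod p) :=
    LinearMap.pi fun i => LinearMap.pi fun k => lcoeff (ZMod p) k ∘ₗ S i
  have : Module.Finite (ZMod p) (degreeLT (ZMod p) n) :=
    Module.Finite.equiv (degreeLTEquiv (ZMod p) n).symm
  have hfin : Module.finrank (ZMod p) (degreeLT (ZMod p) n) = n := by
    rw [(degreeLTEquiv (ZMod p) n).finrank_eq]; simp
  have hlt : Module.finrank (ZMod p) (Fin (2 * L) → Fin M → ZMod p) <
      Module.finrank (ZMod p) V := by
    have hV : Module.finrank (ZMod p) V = 2 * (L + 1) * n := by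
      rw [Module.finrank_pi_fintype]
      simp [hfin]
    have hW : Module.finrank (ZMod p) (Fin (2 * L) → Fin M → ZMod p) = 2 * L * M := by
      rw [Module.finrank_pi_fintype]
      simp
    rw [hV, hW]
    simp only [M]
    linear_combination 2 * hL
  obtain ⟨v, hv, hv0⟩ := (Submodule.ne_bot_iff _).1 (LinearMap.ker_ne_bot_of_finrank_lt hlt)
  refine ⟨fun x => v x, fun h => hv0 ?_, hdeg v, fun i hi => ?_⟩
  · ext1 x
    exact Subtype.ext (congrFun h x)
  · rw [← hS]
    ext k
    by_cases hk : k < M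
    · have hker : Φ v = 0 := hv
      exact congrFun (congrFun hker ⟨i, hi⟩) ⟨k, hk⟩
    · rw [coeff_zero]
      refine coeff_eq_zero_of_natDegree_lt
        (lt_of_le_of_lt ?_ ((not_lt.1 hk).trans_lt' (?_ : M - 1 < M)))
      · rw [hS]
        refine natDegree_sum_le_of_forall_le _ _ fun x _ => ?_
        refine natDegree_mul_le.trans ?_
        rw [natDegree_X_pow]
        have h₁ := (natDegree_C_mul_le (a ^ (x.1 : ℕ))
          (derivativeCofactor f (2 * L + x.1 * (p / 2)) i (v x))).trans
          (natDegree_derivativeCofactor_le _ _ _ _)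
        have h₂ := hdeg v x
        have h₃ : i * f.natDegree ≤ 2 * L * f.natDegree := by gcongr
        have := x.2.2
        simp only [M]
        omega
      · simp only [M]
        omega

/-- Stepanov's bound: a polynomial with a simple root, of degree small compared to `p`, takes
each value of the quadratic character at few more than half of the points. -/
theorem two_mul_mul_card_pow_half_eq_le (hp : p ≠ 2) {f : (ZMod p)[X]} {x : ZMod p}
    (hx : f.rootMultiplicity x = 1) (h0 : f.coeff 0 ≠ 0) {L n : ℕ}
    (hn : 2 * n + f.natDegree < p) (hL : L * (2 * L * f.natDegree + L + 1) < n) (a : ZMod p) :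
    2 * L * (Finset.univ.filter fun y : ZMod p => f.eval y ^ (p / 2) = a).card ≤
      2 * L * f.natDegree + p * f.natDegree + p + L * p := by
  obtain ⟨h, hne, hdeg, hsum⟩ := exists_ne_zero_sum_derivativeCofactor_eq_zero f a hL
  let r : (ZMod p)[X] :=
    ∑ x, f ^ (2 * L + x.1 * (p / 2)) * (h x * X ^ ((x.2 : ℕ) * p))
  have hr : r ≠ 0 := by
    intro hr
    have hf : f ≠ 0 := by rintro rfl; simp at hx
    have : f ^ (2 * L) * (∑ j : Fin (L + 1), h (0, j) * X ^ ((j : ℕ) * p) +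
        f ^ (p / 2) * ∑ j : Fin (L + 1), h (1, j) * X ^ ((j : ℕ) * p)) = 0 := by
      rw [← hr]
      simp only [r, Fintype.sum_prod_type, Fin.sum_univ_two, Finset.mul_sum, mul_add]
      simp [pow_add, mul_assoc]
    have := eq_zero_of_sum_add_pow_mul_sum_eq_zero hp hx h0 hn _ _ (fun j => hdeg _)
      (fun j => hdeg _) ((mul_eq_zero.1 this).resolve_left (pow_ne_zero _ hf))
    apply hne
    ext1 ⟨e, j⟩
    fin_cases e
    · exact (this j).1
    · exact (this j).2
  set T := Finset.univ.filter fun y : ZMod p => f.eval y ^ (p / 2) = a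
  have hroot : ∀ y ∈ T, ∀ i < 2 * L, (derivative^[i] r).IsRoot y := by
    intro y hy i hi
    have hy : f.eval y ^ (p / 2) = a := (Finset.mem_filter.1 hy).2
    have hw (j : ℕ) : derivative ((X : (ZMod p)[X]) ^ (j * p)) = 0 := by
      simp [derivative_X_pow]
    have key := congrArg (eval y) (hsum i hi)
    rw [eval_finsetSum, eval_zero] at key
    rw [IsRoot.def, iterate_derivative_sum, eval_finsetSum,
      ← mul_zero (f.eval y ^ (2 * L - i)), ← key, Finset.mul_sum]
    refine Finset.sum_congr rfl fun x _ => ?_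
    rw [iterate_derivative_pow_mul _ _ _ (by omega),
      derivativeCofactor_mul_of_derivative_eq_zero _ _ _ _ _ (hw _),
      show 2 * L + x.1 * (p / 2) - i = (2 * L - i) + (p / 2) * x.1 by
        rw [mul_comm (x.1 : ℕ)]; omega, pow_add, pow_mul]
    simp only [eval_mul, eval_pow, eval_C, eval_X, hy]
    rw [mul_comm (x.2 : ℕ) p, pow_mul, ZMod.pow_card]
    ring
  have hmult : ∀ y ∈ T, (X - C y) ^ (2 * L) ∣ r := by
    intro y hy
    rcases Nat.eq_zero_or_pos L with rfl | hL0
    · simp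
    rw [← le_rootMultiplicity_iff hr]
    have := lt_rootMultiplicity_of_isRoot_iterate_derivative_of_mem_nonZeroDivisors
      (n := 2 * L - 1) hr (fun m hm => hroot y hy m (by omega)) ?_
    · omega
    · rw [mem_nonZeroDivisors_iff_ne_zero, Ne, CharP.cast_eq_zero_iff _ p,
        (Fact.out : p.Prime).dvd_factorial]
      have : L ≤ L * (2 * L * f.natDegree + L + 1) := Nat.le_mul_of_pos_right _ (by omega)
      omega
  have hprod : ∏ y ∈ T, (X - C y) ^ (2 * L) ∣ r := by
    refine Finset.prod_dvd_of_coprime (fun y _ z _ hyz => ?_) hmult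
    exact (pairwise_coprime_X_sub_C Function.injective_id hyz).pow
  have hle := natDegree_le_of_dvd hprod hr
  rw [natDegree_prod_of_monic _ _ fun y _ => (monic_X_sub_C y).pow _] at hle
  simp only [natDegree_pow, natDegree_X_sub_C, Finset.sum_const, smul_eq_mul, mul_one] at hle
  rw [mul_comm]
  refine hle.trans ?_
  refine natDegree_sum_le_of_forall_le _ _ fun x _ => ?_
  refine natDegree_mul_le.trans ?_
  have h₁ : (f ^ (2 * L + x.1 * (p / 2))).natDegree ≤
      2 * L * f.natDegree + p * f.natDegree := by
    rw [← add_mul]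
    refine natDegree_pow_le.trans ?_
    gcongr
    have := x.1.2
    have : (x.1 : ℕ) * (p / 2) ≤ 1 * (p / 2) := by gcongr; omega
    omega
  have h₂ : (h x * X ^ ((x.2 : ℕ) * p)).natDegree ≤ p + L * p := by
    refine natDegree_mul_le.trans ?_
    rw [natDegree_X_pow]
    have h₃ : (x.2 : ℕ) * p ≤ L * p := by
      gcongr
      have := x.2.2
      omega
    have := hdeg x
    omega
  omega

end Stepanov

section QuadraticCharacterPatterns

open Polynomial

variable {p : ℕ} [Fact p.Prime]

/-- A quadratic character sum over a product of distinct linear factors is small. -/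
theorem abs_sum_quadraticChar_prod_le (hp : p ≠ 2) {S : Finset (ZMod p)} (hS : S.Nonempty)
    (h0 : 0 ∉ S) {L n : ℕ} (hn : 2 * n + S.card < p)
    (hL : L * (2 * L * S.card + L + 1) < n) :
    L * |∑ v, quadraticChar (ZMod p) (∏ c ∈ S, (v - c))| ≤
      (3 * L * S.card + p * (S.card + 1) : ℤ) := by
  set f : (ZMod p)[X] := ∏ c ∈ S, (X - C c) with hf
  have heval (v : ZMod p) : ∏ c ∈ S, (v - c) = f.eval v := by simp [hf, eval_prod]
  have hdeg : f.natDegree = S.card := by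
    rw [hf, natDegree_prod_of_monic _ _ fun c _ => monic_X_sub_C c]
    simp
  obtain ⟨x, hxS⟩ := hS
  have hx : f.rootMultiplicity x = 1 := by
    rw [← count_roots, hf, roots_prod_X_sub_C]
    exact Multiset.count_eq_one_of_mem S.nodup hxS
  have hcoeff : f.coeff 0 ≠ 0 := by
    rw [coeff_zero_eq_eval_zero, ← heval, Finset.prod_ne_zero_iff]
    intro c hc h
    exact h0 (sub_eq_zero.1 h ▸ hc)
  have hchar : ringChar (ZMod p) ≠ 2 := by rwa [ZMod.ringChar_zmod_n]
  set N : ℤ → ℕ := fun a =>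
    (Finset.univ.filter fun v : ZMod p => quadraticChar (ZMod p) (f.eval v) = a).card
  have hN (a : ℤ) :
      2 * L * N a ≤ 2 * L * S.card + p * S.card + p + L * p := by
    have := two_mul_mul_card_pow_half_eq_le hp hx hcoeff (hdeg ▸ hn) (hdeg ▸ hL) (a : ZMod p)
    rw [hdeg] at this
    refine le_trans (Nat.mul_le_mul_left _ (Finset.card_le_card fun v => ?_)) this
    simp only [Finset.mem_filter, Finset.mem_univ, true_and]
    rintro rfl
    rw [quadraticChar_eq_pow_of_char_ne_two' hchar, ZMod.card]
  have hN0 : N 0 ≤ S.card := by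
    refine Finset.card_le_card fun v => ?_
    simp only [Finset.mem_filter, Finset.mem_univ, true_and, quadraticChar_eq_zero_iff, ← heval,
      Finset.prod_eq_zero_iff]
    rintro ⟨c, hc, h⟩
    rwa [sub_eq_zero.1 h]
  have htri (v : ZMod p) : quadraticChar (ZMod p) (f.eval v) = 0 ∨
      quadraticChar (ZMod p) (f.eval v) = 1 ∨ quadraticChar (ZMod p) (f.eval v) = -1 := by
    by_cases h : f.eval v = 0
    · simp [h]
    · exact Or.inr (quadraticChar_dichotomy h)
  have hNsum (a : ℤ) : (N a : ℤ) =
      ∑ v, if quadraticChar (ZMod p) (f.eval v) = a then 1 else 0 := by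
    simp [N]
  have htotal : (N 0 + N 1 + N (-1) : ℤ) = p := by
    rw [hNsum, hNsum, hNsum, ← Finset.sum_add_distrib, ← Finset.sum_add_distrib]
    calc _ = ∑ v : ZMod p, (1 : ℤ) := Finset.sum_congr rfl fun v _ => by
            rcases htri v with h | h | h <;> simp [h]
      _ = p := by simp [ZMod.card]
  have hsum : ∑ v, quadraticChar (ZMod p) (∏ c ∈ S, (v - c)) = (N 1 - N (-1) : ℤ) := by
    rw [hNsum, hNsum, ← Finset.sum_sub_distrib]
    refine Finset.sum_congr rfl fun v _ => ?_
    rw [heval]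
    rcases htri v with h | h | h <;> simp [h]
  rw [hsum]
  have h₁ : (2 * L * N 1 : ℤ) ≤ 2 * L * S.card + p * S.card + p + L * p := by
    exact_mod_cast hN 1
  have h₂ : (2 * L * N (-1) : ℤ) ≤ 2 * L * S.card + p * S.card + p + L * p := by
    exact_mod_cast hN (-1)
  have h₃ : (L * N 0 : ℤ) ≤ L * S.card := by exact_mod_cast Nat.mul_le_mul_left L hN0
  have h₄ : (L * N 0 + L * N 1 + L * N (-1) : ℤ) = L * p := by rw [← htotal]; ring
  rcases abs_cases (N 1 - N (-1) : ℤ) with ⟨h, -⟩ | ⟨h, -⟩ <;> rw [h] <;> linarith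

lemma exists_quadraticChar_sub_eq_of_zero_notMem (hp : p ≠ 2) {k L n : ℕ}
    (hL : L = 2 ^ k * (k + 1) + 1) (hn : n = L * (2 * L * k + L + 1) + 1)
    (hpn : 2 * n + k < p) (hpk : 4 * L * k * 2 ^ k < p) {U : Finset (ZMod p)}
    (hU : U.card ≤ k) (h0 : 0 ∉ U) (ε : ZMod p → ℤ) (hε : ∀ c, ε c = 1 ∨ ε c = -1) :
    ∃ v ∉ U, ∀ c ∈ U, quadraticChar (ZMod p) (v - c) = ε c := by
  by_contra! hcon
  set χ := quadraticChar (ZMod p)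
  have habsε (c) : |ε c| = 1 := by rcases hε c with h | h <;> simp [h]
  have habsχ (x) : |χ x| ≤ 1 := by
    by_cases hx : x = 0
    · simp [χ, hx]
    · rcases quadraticChar_dichotomy hx with h | h <;> simp [χ, h]
  have hpow : (2 : ℤ) ^ U.card ≤ 2 ^ k := pow_le_pow_right₀ (by norm_num) hU
  have hkU : (U.card : ℤ) ≤ k := by exact_mod_cast hU
  have hupper : ∑ v, ∏ c ∈ U, (1 + ε c * χ (v - c)) ≤ (k * 2 ^ k : ℤ) := by
    rw [← Finset.sum_subset (Finset.subset_univ U)]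
    · calc _ ≤ ∑ v ∈ U, (2 ^ k : ℤ) := Finset.sum_le_sum fun v _ => by
            refine (le_abs_self _).trans ?_
            rw [Finset.abs_prod]
            refine le_trans ?_ hpow
            rw [← Finset.prod_const]
            refine Finset.prod_le_prod (fun _ _ => abs_nonneg _) fun c _ => ?_
            refine (abs_add_le _ _).trans ?_
            rw [abs_mul, habsε, abs_one, one_mul]
            linarith [habsχ (v - c)]
        _ ≤ _ := by
            rw [Finset.sum_const, nsmul_eq_mul]
            gcongr
    · intro v _ hv
      obtain ⟨c, hc, hne⟩ := hcon v hv
      refine Finset.prod_eq_zero hc ?_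
      have hvc : v - c ≠ 0 := fun h => hv (sub_eq_zero.1 h ▸ hc)
      rcases quadraticChar_dichotomy hvc with h | h <;> rcases hε c with h' | h' <;>
        simp_all [χ]
  have hexpand : ∑ v, ∏ c ∈ U, (1 + ε c * χ (v - c)) =
      p + ∑ S ∈ U.powerset.erase ∅, (∏ c ∈ S, ε c) * ∑ v, χ (∏ c ∈ S, (v - c)) := by
    simp_rw [Finset.prod_one_add]
    rw [Finset.sum_comm, ← Finset.add_sum_erase _ _ (Finset.empty_mem_powerset U)]
    congr 1
    · simp [ZMod.card]
    · refine Finset.sum_congr rfl fun S _ => ?_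
      rw [Finset.mul_sum]
      refine Finset.sum_congr rfl fun v _ => ?_
      rw [Finset.prod_mul_distrib, map_prod]
  have hterm : ∀ S ∈ U.powerset.erase ∅,
      L * |(∏ c ∈ S, ε c) * ∑ v, χ (∏ c ∈ S, (v - c))| ≤ (3 * L * k + p * (k + 1) : ℤ) := by
    intro S hS
    obtain ⟨hS, hSU⟩ := Finset.mem_erase.1 hS
    rw [Finset.mem_powerset] at hSU
    have hSk : S.card ≤ k := (Finset.card_le_card hSU).trans hU
    rw [abs_mul, Finset.abs_prod, Finset.prod_congr rfl fun c _ => habsε c, Finset.prod_const_one,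
      one_mul]
    refine (abs_sum_quadraticChar_prod_le (n := n) hp (Finset.nonempty_iff_ne_empty.2 hS)
      (fun h => h0 (hSU h)) (by omega) ?_).trans ?_
    · rw [hn, Nat.lt_succ_iff]
      gcongr
    · gcongr
  have hlower : -(2 ^ k * (3 * L * k + p * (k + 1)) : ℤ) ≤
      L * ∑ S ∈ U.powerset.erase ∅, (∏ c ∈ S, ε c) * ∑ v, χ (∏ c ∈ S, (v - c)) := by
    refine neg_le_of_abs_le ?_
    rw [abs_mul, Nat.abs_cast]
    calc _ ≤ (L : ℤ) * ∑ S ∈ U.powerset.erase ∅,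
            |(∏ c ∈ S, ε c) * ∑ v, χ (∏ c ∈ S, (v - c))| := by
          gcongr
          exact Finset.abs_sum_le_sum_abs _ _
      _ ≤ ∑ S ∈ U.powerset.erase ∅, (3 * L * k + p * (k + 1) : ℤ) := by
          rw [Finset.mul_sum]
          exact Finset.sum_le_sum hterm
      _ ≤ _ := by
          rw [Finset.sum_const, nsmul_eq_mul]
          gcongr
          refine le_trans ?_ hpow
          exact_mod_cast (Finset.card_le_card (Finset.erase_subset _ _)).trans
            (Finset.card_powerset U).le
  rw [hexpand] at hupper
  have hmul := mul_le_mul_of_nonneg_left hupper (Nat.cast_nonneg (α := ℤ) L)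
  have hpk' : (4 * L * k * 2 ^ k : ℤ) < p := by exact_mod_cast hpk
  have hLp : (L * p : ℤ) = 2 ^ k * (k + 1) * p + p := by rw [hL]; push_cast; ring
  linarith

/-- For all large primes `p`, every pattern of quadratic characters over at most `k` shifts is
realized. -/
theorem exists_forall_prime_exists_quadraticChar_sub_eq (k : ℕ) :
    ∃ P : ℕ, ∀ p : ℕ, ∀ [Fact p.Prime], P < p → ∀ U : Finset (ZMod p), U.card ≤ k →
      ∀ ε : ZMod p → ℤ, (∀ c, ε c = 1 ∨ ε c = -1) →
        ∃ v ∉ U, ∀ c ∈ U, quadraticChar (ZMod p) (v - c) = ε c := by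
  let L := 2 ^ k * (k + 1) + 1
  let n := L * (2 * L * k + L + 1) + 1
  refine ⟨2 * n + k + 4 * L * k * 2 ^ k + 2, fun p _ hp U hU ε hε => ?_⟩
  obtain ⟨t, ht⟩ : ∃ t, t ∉ U := by
    by_contra! h
    have := Finset.card_le_card (fun x _ => h x : Finset.univ ⊆ U)
    rw [Finset.card_univ, ZMod.card] at this
    omega
  obtain ⟨v, hv, hvε⟩ := exists_quadraticChar_sub_eq_of_zero_notMem (k := k) (L := L) (n := n)
    (U := U.image (· - t)) (by omega) rfl rfl (by omega) (by omega)
    (Finset.card_image_le.trans hU)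
    (by simpa [sub_eq_zero] using ht) (fun c => ε (c + t)) (fun c => hε _)
  refine ⟨v + t, fun h => hv (Finset.mem_image.2 ⟨_, h, by ring⟩), fun c hc => ?_⟩
  have := hvε (c - t) (Finset.mem_image_of_mem _ hc)
  rwa [sub_add_cancel, show v - (c - t) = v + t - c by ring] at this

end QuadraticCharacterPatterns

section PaleyUltraproduct

variable {q : ℕ → ℕ} {D : Ultrafilter ℕ}

lemma relMap_adj_iff_of_eq_coe {v w : (D : Filter ℕ).Product (fun i => ZMod (q i))}
    {x y : ∀ i, ZMod (q i)} (hx : Quotient.mk _ x = v) (hy : Quotient.mk _ y = w) :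
    RelMap Language.adj ![v, w] ↔
      ∀ᶠ i in (D : Filter ℕ), x i ≠ y i ∧ ∃ z, z ^ 2 = x i - y i := by
  subst hx hy
  have h := relMap_quotient_mk' ((D : Filter ℕ).productSetoid fun i => ZMod (q i))
    Language.adj ![x, y]
  refine Iff.trans (Eq.to_iff ?_) h
  congr 1
  ext i
  fin_cases i <;> rfl

end PaleyUltraproduct

/-- Let `(q i)` enumerate the primes `≡ 1 (mod 4)` and `D` a non-principal
ultrafilter on `ℕ`. The ultraproduct `ℳ = ∏_D G_{q i}` of the Paley graphs is a model of the
theory of the random graph: the edge relation `R` is irreflexive and symmetric, and for any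
two disjoint finite subsets `A`, `B` of `ℳ` there is a vertex `𝐯 ∉ A ∪ B` adjacent to every
element of `A` and to no element of `B`. -/
theorem paley_ultraproduct_models_random_graph
    (q : ℕ → ℕ) (hq : ∀ i, (q i).Prime ∧ q i % 4 = 1)
    (hmono : StrictMono q)
    (henum : ∀ p : ℕ, (p.Prime ∧ p % 4 = 1) ↔ ∃ i, q i = p)
    (D : Ultrafilter ℕ) (hD : ∀ i : ℕ, D ≠ pure i) :
    (∀ v : (D : Filter ℕ).Product (fun i => ZMod (q i)),
      ¬ RelMap Language.adj ![v, v]) ∧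
    (∀ v w : (D : Filter ℕ).Product (fun i => ZMod (q i)),
      RelMap Language.adj ![v, w] → RelMap Language.adj ![w, v]) ∧
    (∀ A B : Finset ((D : Filter ℕ).Product (fun i => ZMod (q i))), Disjoint A B →
      ∃ v, v ∉ A ∧ v ∉ B ∧
        (∀ a ∈ A, RelMap Language.adj ![v, a]) ∧
        (∀ b ∈ B, ¬ RelMap Language.adj ![v, b])) := by
  refine ⟨fun v h => ?_, fun v w h => ?_, fun A B hAB => ?_⟩
  · obtain ⟨x, hx⟩ := Quotient.exists_rep v
    obtain ⟨i, hi, -⟩ := ((relMap_adj_iff_of_eq_coe hx hx).1 h).exists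
    exact hi rfl
  · obtain ⟨x, hx⟩ := Quotient.exists_rep v
    obtain ⟨y, hy⟩ := Quotient.exists_rep w
    rw [relMap_adj_iff_of_eq_coe hy hx]
    filter_upwards [(relMap_adj_iff_of_eq_coe hx hy).1 h] with i ⟨hne, z, hz⟩
    have : Fact (q i).Prime := ⟨(hq i).1⟩
    obtain ⟨u, hu⟩ := (ZMod.exists_sq_eq_neg_one_iff (p := q i)).2 (by rw [(hq i).2]; norm_num)
    refine ⟨hne.symm, z * u, ?_⟩
    linear_combination u ^ 2 * hz - (x i - y i) * hu
  · classical
    choose x hx using fun v : (D : Filter ℕ).Product (fun i => ZMod (q i)) => Quotient.exists_rep v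
    obtain ⟨P, hP⟩ := exists_forall_prime_exists_quadraticChar_sub_eq (A ∪ B).card
    have hcof : (D : Filter ℕ) ≤ Filter.cofinite :=
      D.le_cofinite_or_eq_pure.resolve_right fun ⟨i, hi⟩ => hD i hi
    have hlarge : ∀ᶠ i in (D : Filter ℕ), P + 2 < q i := by
      rw [Nat.cofinite_eq_atTop] at hcof
      exact hcof (hmono.tendsto_atTop.eventually_gt_atTop (P + 2))
    have hsep : ∀ᶠ i in (D : Filter ℕ), ∀ a ∈ A, ∀ b ∈ B, x a i ≠ x b i := by
      rw [Filter.eventually_all_finset]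
      intro a ha
      rw [Filter.eventually_all_finset]
      intro b hb
      rw [Ultrafilter.eventually_not]
      intro h
      have hab : a = b := by
        rw [← hx a, ← hx b]
        exact Quotient.sound h
      exact Finset.disjoint_left.1 hAB ha (hab ▸ hb)
    have hgood : ∀ᶠ i in (D : Filter ℕ), ∃ v : ZMod (q i),
        (∀ a ∈ A, v ≠ x a i ∧ ∃ z, z ^ 2 = v - x a i) ∧
        ∀ b ∈ B, v ≠ x b i ∧ ¬ ∃ z, z ^ 2 = v - x b i := by
      filter_upwards [hlarge, hsep] with i hi hs
      have : Fact (q i).Prime := ⟨(hq i).1⟩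
      have hchar : ringChar (ZMod (q i)) ≠ 2 := by rw [ZMod.ringChar_zmod_n]; omega
      obtain ⟨v, hv, hvε⟩ := hP (q i) (by omega) ((A ∪ B).image (x · i)) Finset.card_image_le
        (fun c => if c ∈ A.image (x · i) then 1 else -1) (fun c => by split_ifs <;> simp)
      have hne : ∀ c ∈ A ∪ B, v ≠ x c i :=
        fun c hc h => hv (h ▸ Finset.mem_image_of_mem (x · i) hc)
      refine ⟨v, fun a ha => ?_, fun b hb => ?_⟩
      · have hmem := Finset.mem_union_left B ha
        have h := hvε (x a i) (Finset.mem_image_of_mem (x · i) hmem)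
        rw [if_pos (Finset.mem_image_of_mem (x · i) ha),
          quadraticChar_one_iff_isSquare (sub_ne_zero.2 (hne a hmem))] at h
        obtain ⟨z, hz⟩ := h
        exact ⟨hne a hmem, z, by rw [hz, sq]⟩
      · have hmem := Finset.mem_union_right A hb
        have h := hvε (x b i) (Finset.mem_image_of_mem (x · i) hmem)
        rw [if_neg, quadraticChar_neg_one_iff_not_isSquare] at h
        · exact ⟨hne b hmem, fun ⟨z, hz⟩ => h ⟨z, by rw [← hz, sq]⟩⟩
        · intro hb'
          obtain ⟨a, ha, hab⟩ := Finset.mem_image.1 hb'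
          exact hs a ha b hb hab
    choose! v hv using fun i (h : ∃ v : ZMod (q i),
      (∀ a ∈ A, v ≠ x a i ∧ ∃ z, z ^ 2 = v - x a i) ∧
        ∀ b ∈ B, v ≠ x b i ∧ ¬ ∃ z, z ^ 2 = v - x b i) => h
    have hv' := hgood.mono hv
    have hne : ∀ c, (∀ᶠ i in (D : Filter ℕ), v i ≠ x c i) → Quotient.mk _ v ≠ c := by
      intro c hc h
      rw [← hx c] at h
      obtain ⟨i, hi, hi'⟩ := (hc.and (Quotient.exact h)).exists
      exact hi hi'
    refine ⟨Quotient.mk _ v, fun h => hne _ (hv'.mono fun i hi => (hi.1 _ h).1) rfl,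
      fun h => hne _ (hv'.mono fun i hi => (hi.2 _ h).1) rfl, fun a ha => ?_, fun b hb h => ?_⟩
    · exact (relMap_adj_iff_of_eq_coe rfl (hx a)).2 (hv'.mono fun i hi => hi.1 a ha)
    · obtain ⟨i, hi, hi'⟩ := (((relMap_adj_iff_of_eq_coe rfl (hx b)).1 h).and hv').exists
      exact (hi'.2 b hb).2 hi.2
end

section
/- Let G be a finite group and let μ : G → [0,1] be a probability distribution on G (i.e. Σ_{g∈G} μ(g) = 1). Then μ ∗ μ = μ if and only if there exists a subgroup H of G such that μ is the uniform distribution on H, i.e. μ(g) = 1/|H| for g ∈ H and μ(g) = 0 for g ∉ H. -/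
open scoped BigOperators

/-- Maximum principle: a maximum of `f` that is also the `μ`-average of the left translates of `f`
is attained at every translate in the support of `μ`. -/
lemma apply_inv_mul_eq_of_sum_eq_of_forall_le {G : Type*} [Group G] [Fintype G]
    {μ f : G → ℝ} (hnn : ∀ g, 0 ≤ μ g) (hsum : ∑ g, μ g = 1) {x h : G}
    (hx : ∑ h, μ h * f (h⁻¹ * x) = f x) (hmax : ∀ g, f g ≤ f x) (hh : μ h ≠ 0) :
    f (h⁻¹ * x) = f x := by
  have hzero : ∑ h, μ h * (f x - f (h⁻¹ * x)) = 0 := by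
    simp only [mul_sub, Finset.sum_sub_distrib, ← Finset.sum_mul, hsum, hx, one_mul, sub_self]
  have hterm := (Finset.sum_eq_zero_iff_of_nonneg fun h _ =>
    mul_nonneg (hnn h) (sub_nonneg.2 (hmax _))).1 hzero h (Finset.mem_univ h)
  linarith [(mul_eq_zero.1 hterm).resolve_left hh]

/-- A probability distribution `μ` on a finite group `G` is idempotent under
convolution (`μ ∗ μ = μ`, where `(μ ∗ ν)(g) = Σ_h μ(h)ν(h⁻¹g)`) if and only if `μ` is the
uniform distribution on some subgroup `H` of `G`. -/
theorem idempotent_iff_uniform_on_subgroup {G : Type*} [Group G] [Fintype G]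
    (μ : G → ℝ) (hnn : ∀ g, 0 ≤ μ g) (hsum : ∑ g, μ g = 1) :
    (∀ g, ∑ h, μ h * μ (h⁻¹ * g) = μ g) ↔
      ∃ H : Subgroup G, μ = Set.indicator (H : Set G) (fun _ => (1 : ℝ) / Nat.card H) := by
  classical
  constructor
  · intro hid
    obtain ⟨x, hmax⟩ := Finite.exists_max μ
    have hx : μ x ≠ 0 := by
      intro hx
      have hall : ∀ g, μ g = 0 := fun g => le_antisymm (hx ▸ hmax g) (hnn g)
      simp [hall] at hsum
    have key : ∀ {y h : G}, μ y = μ x → μ h ≠ 0 → μ (h⁻¹ * y) = μ x := fun {y h} hy hh =>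
      (apply_inv_mul_eq_of_sum_eq_of_forall_le hnn hsum (hid y) (fun g => hy ▸ hmax g) hh).trans hy
    have hone : μ 1 = μ x := by simpa using key rfl hx
    have hinv : ∀ {h : G}, μ h ≠ 0 → μ h⁻¹ = μ x := fun hh => by simpa using key hone hh
    let H : Subgroup G :=
      { carrier := {g | μ g ≠ 0}
        one_mem' := by simpa [hone] using hx
        inv_mem' := fun {h} hh => by simpa [hinv hh] using hx
        mul_mem' := fun {a b} ha hb => by
          have ha' : μ a⁻¹ ≠ 0 := by rw [hinv ha]; exact hx
          have hb' : μ b⁻¹ ≠ 0 := by rw [hinv hb]; exact hx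
          have hab := key (by simpa using hinv hb') ha'
          rw [inv_inv] at hab
          simpa [hab] using hx }
    have hmem : ∀ g, g ∈ H ↔ μ g ≠ 0 := fun _ => Iff.rfl
    have hval : ∀ g, μ g = if g ∈ H then μ x else 0 := by
      intro g
      split_ifs with hg
      · have hg' : μ g⁻¹ ≠ 0 := (hmem _).1 (H.inv_mem hg)
        simpa using hinv hg'
      · simpa [hmem] using hg
    have hcard : (Nat.card H : ℝ) * μ x = 1 := by
      rw [← hsum, Finset.sum_congr rfl fun g _ => hval g, ← Finset.sum_filter, Finset.sum_const,
        nsmul_eq_mul, Nat.card_eq_fintype_card, Fintype.card_subtype]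
    refine ⟨H, funext fun g => ?_⟩
    rw [hval g, Set.indicator_apply, eq_one_div_of_mul_eq_one_right hcard]
    rfl
  · rintro ⟨H, hH⟩ g
    have hterm : ∀ h, μ h * μ (h⁻¹ * g) = μ h * μ g := by
      intro h
      by_cases hh : h ∈ H
      · simp [hH, Set.indicator_apply, H.mul_mem_cancel_left (H.inv_mem hh)]
      · simp [hH, hh]
    simp only [hterm, ← Finset.sum_mul, hsum, one_mul]
end
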